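/- Let b : ℝ³ × S² → [0,∞) be measurable with b ∈ L¹(ℝ³ × S²) and b(w,ω) = q(|w|,|w·ω|) for some measurable q. Let f₀ be measurable with 0 ≤ f₀ ≤ 1 a.e. and ∫∫_{ℝ³×ℝ³} (1 + |v|²) f₀(x,v) dx dv < ∞, and let f be the unique mild solution of the Boltzmann–Fermi–Dirac equation with initial datum f₀ satisfying 0 ≤ f ≤ 1 a.e. Then (t,x,v) ↦ |v|² f(t,x,v) belongs to C⁰([0,∞); L¹(ℝ³ × ℝ³)), the total kinetic energy is conserved: ∫∫_{ℝ³×ℝ³} |v|² f(t,x,v) dx dv = ∫∫_{ℝ³×ℝ³} |v|² f₀(x,v) dx dv for all t ≥ 0, and the function (t,x,v) ↦ |v|² Q(f(t,x,·))(v) belongs to L^∞([0,∞); L¹(ℝ³ × ℝ³)). -/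

import Mathlib

open MeasureTheory Metric
open scoped RealInnerProductSpace ENNReal

noncomputable section

/-- Euclidean space `ℝ³`. -/
abbrev R3 : Type := EuclideanSpace ℝ (Fin 3)

/-- The unit sphere `S² ⊂ ℝ³`. -/
abbrev S2 : Type := sphere (0 : R3) 1

/-- The surface measure on the unit sphere `S²`. -/
def sphMeasure : Measure S2 := (volume : Measure R3).toSphere

/-- The precollisional velocity `v' = v - ((v - v*)·ω) ω`. -/
def vPrime (v vs : R3) (ω : S2) : R3 := v - ⟪v - vs, (ω : R3)⟫ • (ω : R3)

/-- The precollisional velocity `v*' = v* + ((v - v*)·ω) ω`. -/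
def vsPrime (v vs : R3) (ω : S2) : R3 := vs + ⟪v - vs, (ω : R3)⟫ • (ω : R3)

/-- The Boltzmann–Fermi–Dirac collision operator with collision kernel `b`:
`Q(f)(v) = ∫_{S²} ∫_{ℝ³} b(v - v*, ω) [f' f*' (1-f)(1-f*) - f f* (1-f')(1-f*')] dv* dω`. -/
def Qcoll (b : R3 × S2 → ℝ) (f : R3 → ℝ) (v : R3) : ℝ :=
  ∫ ω : S2, ∫ vs : R3,
      b (v - vs, ω) *
        (f (vPrime v vs ω) * f (vsPrime v vs ω) * (1 - f v) * (1 - f vs)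
          - f v * f vs * (1 - f (vPrime v vs ω)) * (1 - f (vsPrime v vs ω)))
    ∂(volume : Measure R3) ∂sphMeasure
/-- `f` is a mild solution of the Boltzmann–Fermi–Dirac equation with initial datum `f₀`. -/
def IsMildSolution (b : R3 × S2 → ℝ) (f₀ : R3 × R3 → ℝ) (f : ℝ × R3 × R3 → ℝ) : Prop :=
  ∀ᵐ q : R3 × R3 ∂(volume : Measure (R3 × R3)), ∀ t : ℝ, 0 ≤ t →
    f (t, q.1 + t • q.2, q.2) =
      f₀ q + ∫ s in (0 : ℝ)..t, Qcoll b (fun w => f (s, q.1 + s • q.2, w)) q.2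


instance sphMeasure_finite : IsFiniteMeasure sphMeasure := by
  unfold sphMeasure; infer_instance

/-- the collision map as linear map for fixed ω -/
def collLin (ω : S2) : (R3 × R3) →ₗ[ℝ] (R3 × R3) where
  toFun p := (vPrime p.1 p.2 ω, vsPrime p.1 p.2 ω)
  map_add' p q := by
    ext1
    · simp only [vPrime, Prod.fst_add, Prod.snd_add]
      rw [add_sub_add_comm, inner_add_left, add_smul]; abel
    · simp only [vsPrime, Prod.fst_add, Prod.snd_add]
      rw [add_sub_add_comm, inner_add_left, add_smul]; abel
  map_smul' c p := by
    ext1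
    · simp only [vPrime, Prod.smul_fst, Prod.smul_snd, RingHom.id_apply]
      rw [← smul_sub, real_inner_smul_left, mul_smul, ← smul_sub]
    · simp only [vsPrime, Prod.smul_fst, Prod.smul_snd, RingHom.id_apply]
      rw [← smul_sub, real_inner_smul_left, mul_smul, ← smul_add]

lemma S2_inner (ω : S2) : ⟪(ω : R3), (ω : R3)⟫ = 1 := by
  have : ‖(ω : R3)‖ = 1 := by simp
  rw [real_inner_self_eq_norm_sq, this]; norm_num

lemma prime_sub (v vs : R3) (ω : S2) :
    vPrime v vs ω - vsPrime v vs ω = (v - vs) - (2 * ⟪v - vs, (ω : R3)⟫) • (ω : R3) := by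
  unfold vPrime vsPrime
  rw [two_mul, add_smul]; abel

lemma prime_sub_inner (v vs : R3) (ω : S2) :
    ⟪vPrime v vs ω - vsPrime v vs ω, (ω : R3)⟫ = - ⟪v - vs, (ω : R3)⟫ := by
  rw [prime_sub, inner_sub_left, real_inner_smul_left, S2_inner]; ring

lemma prime_sub_norm (v vs : R3) (ω : S2) :
    ‖vPrime v vs ω - vsPrime v vs ω‖ = ‖v - vs‖ := by
  rw [prime_sub]
  have h : ‖(v - vs) - (2 * ⟪v - vs, (ω : R3)⟫) • (ω : R3)‖ ^ 2 = ‖v - vs‖ ^ 2 := by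
    rw [← real_inner_self_eq_norm_sq, ← real_inner_self_eq_norm_sq]
    simp only [inner_sub_left, inner_sub_right, real_inner_smul_left, real_inner_smul_right,
      S2_inner, real_inner_comm (ω : R3)]
    ring
  exact (sq_eq_sq₀ (norm_nonneg _) (norm_nonneg _)).1 h

lemma prime_energy (v vs : R3) (ω : S2) :
    ‖vPrime v vs ω‖ ^ 2 + ‖vsPrime v vs ω‖ ^ 2 = ‖v‖ ^ 2 + ‖vs‖ ^ 2 := by
  unfold vPrime vsPrime
  simp only [← real_inner_self_eq_norm_sq]
  simp only [inner_sub_left, inner_sub_right, inner_add_left, inner_add_right,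
    real_inner_smul_left, real_inner_smul_right,
      S2_inner, real_inner_comm (ω : R3)]
  ring

lemma vPrime_vPrime (v vs : R3) (ω : S2) :
    vPrime (vPrime v vs ω) (vsPrime v vs ω) ω = v := by
  conv_lhs => unfold vPrime
  rw [show (v - ⟪v - vs, (ω : R3)⟫ • (ω : R3)) = vPrime v vs ω from rfl, prime_sub_inner]
  unfold vPrime; simp

lemma vsPrime_vsPrime (v vs : R3) (ω : S2) :
    vsPrime (vPrime v vs ω) (vsPrime v vs ω) ω = vs := by
  conv_lhs => unfold vsPrime
  rw [show (vs + ⟪v - vs, (ω : R3)⟫ • (ω : R3)) = vsPrime v vs ω from rfl, prime_sub_inner]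
  unfold vsPrime; simp

lemma vPrime_swap (v vs : R3) (ω : S2) : vPrime vs v ω = vsPrime v vs ω := by
  unfold vPrime vsPrime
  rw [← neg_sub v vs, inner_neg_left]; simp

lemma vsPrime_swap (v vs : R3) (ω : S2) : vsPrime vs v ω = vPrime v vs ω := by
  unfold vPrime vsPrime
  rw [← neg_sub v vs, inner_neg_left]; simp [sub_eq_add_neg]

lemma collLin_mp (ω : S2) : MeasurePreserving (collLin ω)
    ((volume : Measure R3).prod volume) ((volume : Measure R3).prod volume) := by
  have hcomp : collLin ω ∘ₗ collLin ω = LinearMap.id := by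
    refine LinearMap.ext fun p => ?_
    exact Prod.ext (vPrime_vPrime p.1 p.2 ω) (vsPrime_vsPrime p.1 p.2 ω)
  have hdet : (collLin ω).det * (collLin ω).det = 1 := by
    rw [← LinearMap.det_comp, hcomp, LinearMap.det_id]
  have habs : |(collLin ω).det| = 1 := by
    rcases mul_self_eq_one_iff.1 hdet with h | h <;> rw [h] <;> simp
  refine ⟨(LinearMap.continuous_of_finiteDimensional _).measurable, ?_⟩
  rw [Measure.map_linearMap_addHaar_eq_smul_addHaar _ (by intro h; rw [h] at hdet; simp at hdet)]
  rw [abs_inv, habs]; simp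

@[fun_prop]
lemma measurable_vPrime_comp {Z : Type*} [MeasurableSpace Z] {f g : Z → R3} {h : Z → S2}
    (hf : Measurable f) (hg : Measurable g) (hh : Measurable h) :
    Measurable fun z => vPrime (f z) (g z) (h z) := by
  unfold vPrime
  fun_prop

@[fun_prop]
lemma measurable_vsPrime_comp {Z : Type*} [MeasurableSpace Z] {f g : Z → R3} {h : Z → S2}
    (hf : Measurable f) (hg : Measurable g) (hh : Measurable h) :
    Measurable fun z => vsPrime (f z) (g z) (h z) := by
  unfold vsPrime
  fun_prop

lemma measurable_vPrime : Measurable fun p : S2 × R3 × R3 => vPrime p.2.1 p.2.2 p.1 := by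
  unfold vPrime
  fun_prop

lemma measurable_vsPrime : Measurable fun p : S2 × R3 × R3 => vsPrime p.2.1 p.2.2 p.1 := by
  unfold vsPrime
  fun_prop

/-- measure on (ω, v, vs) -/
def mu3 : Measure (S2 × R3 × R3) := sphMeasure.prod (volume.prod volume)

def Phi (p : S2 × R3 × R3) : S2 × R3 × R3 :=
  (p.1, vPrime p.2.1 p.2.2 p.1, vsPrime p.2.1 p.2.2 p.1)

def Sig (p : S2 × R3 × R3) : S2 × R3 × R3 := (p.1, p.2.2, p.2.1)

lemma Phi_mp : MeasurePreserving Phi mu3 mu3 := by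
  unfold mu3
  refine MeasurePreserving.skew_product (f := id) (g := fun ω p => collLin ω p)
    (MeasurePreserving.id _) ?_ ?_
  · exact (measurable_vPrime.prodMk measurable_vsPrime)
  · exact Filter.Eventually.of_forall fun ω => (collLin_mp ω).map_eq

lemma Sig_mp : MeasurePreserving Sig mu3 mu3 := by
  unfold mu3
  exact (MeasurePreserving.id _).prod Measure.measurePreserving_swap

lemma shear_mp (t : ℝ) : MeasurePreserving (fun q : R3 × R3 => (q.1 + t • q.2, q.2))
    (volume : Measure (R3 × R3)) volume := by
  have h : MeasurePreserving (fun q : R3 × R3 => (q.1, q.2 + t • q.1))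
    ((volume : Measure R3).prod volume) (volume.prod volume) := by
    refine MeasurePreserving.skew_product (f := id) (g := fun (v x : R3) => x + t • v)
      (MeasurePreserving.id _) ?_ ?_
    · fun_prop
    · exact Filter.Eventually.of_forall fun ω => (measurePreserving_add_right _ _).map_eq
  exact (Measure.measurePreserving_swap.comp h).comp Measure.measurePreserving_swap

def nu2 : Measure (S2 × R3) := sphMeasure.prod volume

instance : SFinite nu2 := by unfold nu2; infer_instance

def be (b : R3 × S2 → ℝ) (p : S2 × R3 × R3) : ℝ≥0∞ := ENNReal.ofReal (b (p.2.1 - p.2.2, p.1))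

def bB (b : R3 × S2 → ℝ) : ℝ≥0∞ :=
  ∫⁻ p, ENNReal.ofReal (b p) ∂((volume : Measure R3).prod sphMeasure)

def Op (b : R3 × S2 → ℝ) (k : S2 × R3 × R3 → ℝ≥0∞) (v : R3) : ℝ≥0∞ :=
  ∫⁻ p : S2 × R3, be b (p.1, v, p.2) * k (p.1, v, p.2) ∂nu2

def kP (G : R3 → ℝ≥0∞) (p : S2 × R3 × R3) : ℝ≥0∞ := G p.2.1 * G p.2.2

def kL (G : R3 → ℝ≥0∞) (p : S2 × R3 × R3) : ℝ≥0∞ :=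
  G p.2.1 * G p.2.2 * (1 - G (Phi p).2.1) * (1 - G (Phi p).2.2)

def kQ (G : R3 → ℝ≥0∞) (p : S2 × R3 × R3) : ℝ≥0∞ := G (Phi p).2.1 * G (Phi p).2.2

def kG (G : R3 → ℝ≥0∞) (p : S2 × R3 × R3) : ℝ≥0∞ :=
  G (Phi p).2.1 * G (Phi p).2.2 * (1 - G p.2.1) * (1 - G p.2.2)

def e2 (v : R3) : ℝ≥0∞ := ENNReal.ofReal (‖v‖ ^ 2)

lemma measurable_Phi : Measurable Phi := Phi_mp.measurable
lemma measurable_Sig : Measurable Sig := Sig_mp.measurable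

@[fun_prop]
lemma measurable_e2 : Measurable e2 := by unfold e2; fun_prop

lemma Phi_Phi (p : S2 × R3 × R3) : Phi (Phi p) = p := by
  unfold Phi
  simp only [vPrime_vPrime, vsPrime_vsPrime]

lemma Phi_Sig (p : S2 × R3 × R3) : Phi (Sig p) = Sig (Phi p) := by
  unfold Phi Sig
  simp only []
  rw [vPrime_swap p.2.1 p.2.2, vsPrime_swap p.2.1 p.2.2]

lemma e2_Phi (p : S2 × R3 × R3) :
    e2 (Phi p).2.1 + e2 (Phi p).2.2 = e2 p.2.1 + e2 p.2.2 := by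
  unfold e2 Phi
  rw [← ENNReal.ofReal_add (by positivity) (by positivity), prime_energy,
    ENNReal.ofReal_add (by positivity) (by positivity)]

section
variable {b : R3 × S2 → ℝ}

lemma be_Phi (hb_sym : ∃ q : ℝ × ℝ → ℝ, Measurable q ∧
      ∀ (w : R3) (ω : S2), b (w, ω) = q (‖w‖, |⟪w, (ω : R3)⟫|)) (p : S2 × R3 × R3) :
    be b (Phi p) = be b p := by
  obtain ⟨q, -, hq⟩ := hb_sym
  unfold be Phi
  simp only [hq, prime_sub_norm, prime_sub_inner, abs_neg]

lemma be_Sig (hb_sym : ∃ q : ℝ × ℝ → ℝ, Measurable q ∧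
      ∀ (w : R3) (ω : S2), b (w, ω) = q (‖w‖, |⟪w, (ω : R3)⟫|)) (p : S2 × R3 × R3) :
    be b (Sig p) = be b p := by
  obtain ⟨q, -, hq⟩ := hb_sym
  unfold be Sig
  simp only [hq]
  rw [← neg_sub p.2.1 p.2.2, norm_neg, inner_neg_left, abs_neg]

lemma measurable_be (hb : Measurable b) : Measurable (be b) := by unfold be; fun_prop

lemma lintegral_mu3 {h : S2 × R3 × R3 → ℝ≥0∞} (hh : Measurable h) :
    ∫⁻ p, h p ∂mu3 = ∫⁻ v, ∫⁻ p : S2 × R3, h (p.1, v, p.2) ∂nu2 := by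
  unfold mu3 nu2
  rw [lintegral_prod _ hh.aemeasurable]
  have h1 : ∀ v : R3, ∫⁻ p : S2 × R3, h (p.1, v, p.2) ∂(sphMeasure.prod volume)
      = ∫⁻ ω, (∫⁻ vs, h (ω, v, vs)) ∂sphMeasure := by
    intro v
    rw [lintegral_prod]
    exact (by fun_prop : Measurable fun p : S2 × R3 => h (p.1, v, p.2)).aemeasurable
  simp_rw [h1]
  symm
  rw [lintegral_lintegral_swap]
  · symm
    refine lintegral_congr fun ω => ?_
    rw [lintegral_prod]
    exact (by fun_prop : Measurable fun p : R3 × R3 => h (ω, p.1, p.2)).aemeasurable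
  · refine Measurable.aemeasurable ?_
    exact Measurable.lintegral_prod_right' (ν := (volume : Measure R3))
      (f := fun x : (R3 × S2) × R3 => h (x.1.2, x.1.1, x.2)) (by fun_prop)

lemma lintegral_Op (hb : Measurable b) {k : S2 × R3 × R3 → ℝ≥0∞} (hk : Measurable k)
    {w : R3 → ℝ≥0∞} (hw : Measurable w) :
    ∫⁻ v, w v * Op b k v = ∫⁻ p, w p.2.1 * (be b p * k p) ∂mu3 := by
  have := measurable_be hb
  rw [lintegral_mu3 (by fun_prop)]
  refine lintegral_congr fun v => ?_
  unfold Op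
  rw [← lintegral_const_mul]
  fun_prop

lemma bB_eq (hb : Measurable b) :
    bB b = ∫⁻ ω, (∫⁻ w, ENNReal.ofReal (b (w, ω))) ∂sphMeasure := by
  unfold bB
  rw [lintegral_prod_symm]
  exact (by fun_prop : Measurable fun p => ENNReal.ofReal (b p)).aemeasurable

lemma Op_one (hb : Measurable b) (v : R3) : Op b (fun _ => 1) v = bB b := by
  unfold Op nu2
  have := measurable_be hb
  simp only [mul_one]
  rw [bB_eq hb, lintegral_prod _ (by fun_prop)]
  refine lintegral_congr fun ω => ?_
  unfold be
  exact lintegral_sub_left_eq_self (fun w => ENNReal.ofReal (b (w, ω))) v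

lemma Op_mono {k k' : S2 × R3 × R3 → ℝ≥0∞} (h : ∀ p, k p ≤ k' p) (v : R3) :
    Op b k v ≤ Op b k' v :=
  lintegral_mono fun _ => mul_le_mul_right (h _) _

lemma Op_le (hb : Measurable b) {k : S2 × R3 × R3 → ℝ≥0∞} (h : ∀ p, k p ≤ 1) (v : R3) :
    Op b k v ≤ bB b := (Op_mono h v).trans (Op_one hb v).le

lemma Op_const (hb : Measurable b) (c : ℝ≥0∞) (v : R3) : Op b (fun _ => c) v = bB b * c := by
  rw [← Op_one hb v]
  unfold Op
  have := measurable_be hb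
  simp only [mul_one]
  rw [lintegral_mul_const]
  fun_prop

lemma Op_add (hb : Measurable b) {k k' : S2 × R3 × R3 → ℝ≥0∞} (hk : Measurable k) (v : R3) :
    Op b (fun p => k p + k' p) v = Op b k v + Op b k' v := by
  unfold Op
  have := measurable_be hb
  simp only [mul_add]
  rw [lintegral_add_left]
  fun_prop

lemma inv_Phi {h : S2 × R3 × R3 → ℝ≥0∞} (hh : Measurable h) :
    ∫⁻ p, h (Phi p) ∂mu3 = ∫⁻ p, h p ∂mu3 := Phi_mp.lintegral_comp hh

lemma inv_Sig {h : S2 × R3 × R3 → ℝ≥0∞} (hh : Measurable h) :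
    ∫⁻ p, h (Sig p) ∂mu3 = ∫⁻ p, h p ∂mu3 := Sig_mp.lintegral_comp hh

variable {G : R3 → ℝ≥0∞}

lemma measurable_kP (hG : Measurable G) : Measurable (kP G) := by unfold kP; fun_prop
lemma measurable_kL (hG : Measurable G) : Measurable (kL G) := by
  have := measurable_Phi
  unfold kL; fun_prop
lemma measurable_kQ (hG : Measurable G) : Measurable (kQ G) := by
  have := measurable_Phi
  unfold kQ; fun_prop
lemma measurable_kG (hG : Measurable G) : Measurable (kG G) := by
  have := measurable_Phi
  unfold kG; fun_prop

lemma kG_Phi (p : S2 × R3 × R3) : kG G (Phi p) = kL G p := by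
  unfold kG kL; rw [Phi_Phi]

lemma kL_Phi (p : S2 × R3 × R3) : kL G (Phi p) = kG G p := by
  unfold kG kL; rw [Phi_Phi]

lemma kL_Sig (p : S2 × R3 × R3) : kL G (Sig p) = kL G p := by
  unfold kL; rw [Phi_Sig]; unfold Sig; simp only; ring

lemma kG_Sig (p : S2 × R3 × R3) : kG G (Sig p) = kG G p := by
  unfold kG; rw [Phi_Sig]; unfold Sig; simp only; ring

lemma kP_Sig (p : S2 × R3 × R3) : kP G (Sig p) = kP G p := by
  unfold kP Sig; simp only; ring

lemma kQ_Phi (p : S2 × R3 × R3) : kQ G (Phi p) = kP G p := by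
  unfold kQ kP; rw [Phi_Phi]

lemma kG_le_kQ (p : S2 × R3 × R3) : kG G p ≤ kQ G p := by
  unfold kG kQ
  refine (mul_le_of_le_one_right' tsub_le_self).trans (mul_le_of_le_one_right' tsub_le_self)

lemma kQ_le (hG : ∀ v, G v ≤ 1) (p : S2 × R3 × R3) : kQ G p ≤ 1 := mul_le_one' (hG _) (hG _)

lemma kL_le (hG : ∀ v, G v ≤ 1) (p : S2 × R3 × R3) : kL G p ≤ 1 := by
  rw [← kG_Phi]; exact (kG_le_kQ _).trans (kQ_le hG _)

/-- energy bound for the full gain term -/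
lemma energy_kQ (hb : Measurable b) (hb_sym : ∃ q : ℝ × ℝ → ℝ, Measurable q ∧
      ∀ (w : R3) (ω : S2), b (w, ω) = q (‖w‖, |⟪w, (ω : R3)⟫|))
    (hG : Measurable G) (hG1 : ∀ v, G v ≤ 1) :
    ∫⁻ v, e2 v * Op b (kQ G) v ≤ 2 * bB b * ∫⁻ v, e2 v * G v := by
  have h1 := measurable_be hb
  have h2 := measurable_kQ hG
  have h3 := measurable_kP hG
  have h4 := measurable_Phi
  have h5 := measurable_Sig
  have hX : ∫⁻ p, e2 p.2.1 * (be b p * kP G p) ∂mu3 ≤ bB b * ∫⁻ v, e2 v * G v := by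
    calc ∫⁻ p, e2 p.2.1 * (be b p * kP G p) ∂mu3
        ≤ ∫⁻ p, e2 p.2.1 * G p.2.1 * (be b p * 1) ∂mu3 := by
          refine lintegral_mono fun p => ?_
          calc e2 p.2.1 * (be b p * kP G p) = e2 p.2.1 * G p.2.1 * (be b p * G p.2.2) := by
                unfold kP; ring
            _ ≤ _ := by gcongr; exact hG1 _
      _ = ∫⁻ v, e2 v * G v * Op b (fun _ => 1) v := by
          rw [lintegral_Op hb (k := fun _ => 1) (w := fun v => e2 v * G v) (by fun_prop) (by fun_prop)]
      _ = bB b * ∫⁻ v, e2 v * G v := by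
          simp_rw [Op_one hb]
          rw [lintegral_mul_const _ (by fun_prop), mul_comm]
  calc ∫⁻ v, e2 v * Op b (kQ G) v = ∫⁻ p, e2 p.2.1 * (be b p * kQ G p) ∂mu3 :=
        lintegral_Op hb h2 measurable_e2
    _ = ∫⁻ p, e2 (Phi p).2.1 * (be b p * kP G p) ∂mu3 := by
        rw [← inv_Phi (by fun_prop)]
        simp only [be_Phi hb_sym, kQ_Phi]
    _ ≤ ∫⁻ p, (e2 p.2.1 * (be b p * kP G p) + e2 p.2.2 * (be b p * kP G p)) ∂mu3 := by
        refine lintegral_mono fun p => ?_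
        simp only []
        rw [← add_mul, ← e2_Phi]
        gcongr
        exact le_self_add
    _ = ∫⁻ p, e2 p.2.1 * (be b p * kP G p) ∂mu3 + ∫⁻ p, e2 p.2.2 * (be b p * kP G p) ∂mu3 :=
        lintegral_add_left (by fun_prop) _
    _ = ∫⁻ p, e2 p.2.1 * (be b p * kP G p) ∂mu3 + ∫⁻ p, e2 p.2.1 * (be b p * kP G p) ∂mu3 := by
        congr 1
        rw [← inv_Sig (by fun_prop)]
        simp only [be_Sig hb_sym, kP_Sig]
        rfl
    _ ≤ _ := by
        rw [two_mul, add_mul]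
        gcongr

lemma energy_eq (hb : Measurable b) (hb_sym : ∃ q : ℝ × ℝ → ℝ, Measurable q ∧
      ∀ (w : R3) (ω : S2), b (w, ω) = q (‖w‖, |⟪w, (ω : R3)⟫|))
    (hG : Measurable G) :
    ∫⁻ v, e2 v * Op b (kG G) v = ∫⁻ v, e2 v * Op b (kL G) v := by
  have h1 := measurable_be hb
  have h2 := measurable_kG hG
  have h3 := measurable_kL hG
  have h4 := measurable_Phi
  have h5 := measurable_Sig
  rw [lintegral_Op hb h2 measurable_e2, lintegral_Op hb h3 measurable_e2]
  set Y := ∫⁻ p, e2 p.2.1 * (be b p * kG G p) ∂mu3 with hY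
  set X := ∫⁻ p, e2 p.2.1 * (be b p * kL G p) ∂mu3 with hX
  have hX' : X = ∫⁻ p, e2 p.2.2 * (be b p * kL G p) ∂mu3 := by
    rw [hX, ← inv_Sig (by fun_prop)]
    simp only [be_Sig hb_sym, kL_Sig]
    rfl
  have hY1 : Y = ∫⁻ p, e2 (Phi p).2.1 * (be b p * kL G p) ∂mu3 := by
    rw [hY, ← inv_Phi (by fun_prop)]
    simp only [be_Phi hb_sym, kG_Phi]
  have hY2 : Y = ∫⁻ p, e2 (Phi p).2.2 * (be b p * kL G p) ∂mu3 := by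
    rw [hY1, ← inv_Sig (by fun_prop)]
    simp only [be_Sig hb_sym, kL_Sig, Phi_Sig]
    rfl
  have h2X : X + X = Y + Y := by
    calc X + X = ∫⁻ p, e2 p.2.1 * (be b p * kL G p) ∂mu3
          + ∫⁻ p, e2 p.2.2 * (be b p * kL G p) ∂mu3 := by rw [← hX']
      _ = ∫⁻ p, (e2 p.2.1 * (be b p * kL G p) + e2 p.2.2 * (be b p * kL G p)) ∂mu3 :=
        (lintegral_add_left (by fun_prop) _).symm
      _ = ∫⁻ p, (e2 (Phi p).2.1 * (be b p * kL G p) + e2 (Phi p).2.2 * (be b p * kL G p)) ∂mu3 := by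
        simp only [← add_mul, e2_Phi]
      _ = _ := by
        rw [lintegral_add_left (by fun_prop), ← hY1, ← hY2]
  rw [← two_mul, ← two_mul] at h2X
  exact ((ENNReal.mul_right_inj (by norm_num) (by norm_num)).1 h2X).symm

/-- transfer of a.e. statements -/
lemma ae_coll {P : R3 → Prop} (hP : ∀ᵐ v, P v) :
    ∀ᵐ v, ∀ᵐ p : S2 × R3 ∂nu2, P v ∧ P p.2 ∧ P (vPrime v p.2 p.1) ∧ P (vsPrime v p.2 p.1) := by
  obtain ⟨N, hN, hNm, hN0⟩ : ∃ N : Set R3, {v | ¬ P v} ⊆ N ∧ MeasurableSet N ∧ volume N = 0 :=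
    ⟨toMeasurable volume {v | ¬ P v}, subset_toMeasurable _ _, measurableSet_toMeasurable _ _, by
      rw [measure_toMeasurable]; exact hP⟩
  have hq1 : Measure.QuasiMeasurePreserving (fun p : S2 × R3 × R3 => p.2.1) mu3 volume :=
    Measure.quasiMeasurePreserving_fst.comp Measure.quasiMeasurePreserving_snd
  have hq2 : Measure.QuasiMeasurePreserving (fun p : S2 × R3 × R3 => p.2.2) mu3 volume :=
    Measure.quasiMeasurePreserving_snd.comp Measure.quasiMeasurePreserving_snd
  have hq3 := hq1.comp Phi_mp.quasiMeasurePreserving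
  have hq4 := hq2.comp Phi_mp.quasiMeasurePreserving
  have hPN : ∀ᵐ v, v ∉ N := measure_eq_zero_iff_ae_notMem.1 hN0
  have hall : ∀ᵐ p ∂mu3, p ∉ {p : S2 × R3 × R3 | ¬ (p.2.1 ∉ N ∧ p.2.2 ∉ N ∧ (Phi p).2.1 ∉ N
      ∧ (Phi p).2.2 ∉ N)} := by
    filter_upwards [hq1.ae hPN, hq2.ae hPN, hq3.ae hPN, hq4.ae hPN] with p a1 a2 a3 a4
    simpa using ⟨a1, a2, a3, a4⟩
  set S := {p : S2 × R3 × R3 | ¬ (p.2.1 ∉ N ∧ p.2.2 ∉ N ∧ (Phi p).2.1 ∉ N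
      ∧ (Phi p).2.2 ∉ N)} with hS
  have hSm : MeasurableSet S := by
    refine MeasurableSet.compl (MeasurableSet.inter ?_ (MeasurableSet.inter ?_
      (MeasurableSet.inter ?_ ?_)))
    · exact hq1.measurable hNm.compl
    · exact hq2.measurable hNm.compl
    · exact hq3.measurable hNm.compl
    · exact hq4.measurable hNm.compl
  have hS0 : mu3 S = 0 := measure_eq_zero_iff_ae_notMem.2 hall
  rw [← lintegral_indicator_one hSm, lintegral_mu3 (measurable_one.indicator hSm),
    lintegral_eq_zero_iff] at hS0
  · filter_upwards [hS0] with v hv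
    rw [Pi.zero_apply, lintegral_eq_zero_iff] at hv
    · filter_upwards [hv] with p hp
      have hp' : (p.1, v, p.2) ∉ S := by
        intro hmem
        simp [Set.indicator_of_mem hmem] at hp
      simp only [hS, Set.mem_ofPred_eq, not_not] at hp'
      have key : ∀ w, w ∉ N → P w := fun w hw => by
        by_contra h
        exact hw (hN h)
      exact ⟨key _ hp'.1, key _ hp'.2.1, key _ hp'.2.2.1, key _ hp'.2.2.2⟩
    · exact (measurable_one.indicator hSm).comp (by fun_prop)
  · exact Measurable.lintegral_prod_right' (ν := nu2)
      (f := fun x : R3 × (S2 × R3) => S.indicator 1 (x.2.1, x.1, x.2.2))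
      ((measurable_one.indicator hSm).comp (by fun_prop))

/-- comparison lemma -/
lemma kQ_compare (hb : Measurable b) {H : R3 → ℝ≥0∞} (hH : Measurable H)
    (hG1 : ∀ v, G v ≤ 1) (hH1 : ∀ v, H v ≤ 1) (c : ℝ≥0∞) (h : ∀ᵐ v, G v ≤ H v + c) :
    ∀ᵐ v, Op b (kQ G) v ≤ Op b (kQ H) v + 2 * bB b * c := by
  filter_upwards [ae_coll h] with v hv
  have : 2 * bB b * c = Op b (fun _ => 2 * c) v := by rw [Op_const hb]; ring
  rw [this, ← Op_add hb (measurable_kQ hH)]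
  refine lintegral_mono_ae ?_
  filter_upwards [hv] with p hp
  obtain ⟨-, -, h3, h4⟩ := hp
  gcongr
  unfold kQ Phi
  simp only
  calc G (vPrime v p.2 p.1) * G (vsPrime v p.2 p.1)
      ≤ (H (vPrime v p.2 p.1) + c) * G (vsPrime v p.2 p.1) := by gcongr
    _ = H (vPrime v p.2 p.1) * G (vsPrime v p.2 p.1) + c * G (vsPrime v p.2 p.1) := by ring
    _ ≤ H (vPrime v p.2 p.1) * (H (vsPrime v p.2 p.1) + c) + c * 1 := by
        gcongr
        exact hG1 _
    _ = H (vPrime v p.2 p.1) * H (vsPrime v p.2 p.1) + (H (vPrime v p.2 p.1) * c + c) := by ring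
    _ ≤ H (vPrime v p.2 p.1) * H (vsPrime v p.2 p.1) + (1 * c + c) := by
        gcongr
        exact hH1 _
    _ = _ := by ring
end

/-- clipped ENNReal version -/
def clp (g : ℝ) : ℝ≥0∞ := min 1 (ENNReal.ofReal g)

lemma clp_le (g : ℝ) : clp g ≤ 1 := min_le_left _ _

@[fun_prop]
lemma measurable_clp : Measurable clp := by unfold clp; fun_prop

lemma clp_eq {g : ℝ} (h : 0 ≤ g ∧ g ≤ 1) : clp g = ENNReal.ofReal g := by
  unfold clp
  exact min_eq_right (by simpa using h.2)

section
variable {b : R3 × S2 → ℝ}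

lemma Op_toReal (hb : Measurable b) (hb0 : ∀ p, 0 ≤ b p) (v : R3) {k : S2 × R3 × R3 → ℝ≥0∞}
    {r : S2 × R3 → ℝ} (hr : Measurable r) (hfin : Op b k v ≠ ∞)
    (h : ∀ᵐ p ∂nu2, 0 ≤ r p ∧ k (p.1, v, p.2) = ENNReal.ofReal (r p)) :
    Integrable (fun p : S2 × R3 => b (v - p.2, p.1) * r p) nu2 ∧
    ∫ p : S2 × R3, b (v - p.2, p.1) * r p ∂nu2 = (Op b k v).toReal := by
  have h0 : 0 ≤ᵐ[nu2] fun p : S2 × R3 => b (v - p.2, p.1) * r p := by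
    filter_upwards [h] with p hp
    exact mul_nonneg (hb0 _) hp.1
  have hm : AEStronglyMeasurable (fun p : S2 × R3 => b (v - p.2, p.1) * r p) nu2 := by
    have : Measurable (fun p : S2 × R3 => b (v - p.2, p.1) * r p) := by fun_prop
    exact this.aestronglyMeasurable
  have he : ∫⁻ p : S2 × R3, ENNReal.ofReal (b (v - p.2, p.1) * r p) ∂nu2 = Op b k v := by
    unfold Op
    refine lintegral_congr_ae ?_
    filter_upwards [h] with p hp
    rw [hp.2, ENNReal.ofReal_mul (hb0 _)]
    rfl
  refine ⟨⟨hm, ?_⟩, ?_⟩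
  · rw [hasFiniteIntegral_iff_ofReal h0, he]
    exact lt_top_iff_ne_top.2 hfin
  · rw [integral_eq_lintegral_of_nonneg_ae h0 hm, he]

lemma Qcoll_eq (hb : Measurable b) (hb0 : ∀ p, 0 ≤ b p) (hB : bB b ≠ ∞)
    {g : R3 → ℝ} (hg : Measurable g) (hg1 : ∀ᵐ v, 0 ≤ g v ∧ g v ≤ 1) :
    ∀ᵐ v, Qcoll b g v = (Op b (kG fun w => clp (g w)) v).toReal
      - (Op b (kL fun w => clp (g w)) v).toReal := by
  filter_upwards [ae_coll hg1] with v hv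
  have hGfin : Op b (kG fun w => clp (g w)) v ≠ ∞ :=
    ne_top_of_le_ne_top hB (Op_le hb (fun p => (kG_le_kQ p).trans (kQ_le (fun _ => clp_le _) p)) v)
  have hLfin : Op b (kL fun w => clp (g w)) v ≠ ∞ :=
    ne_top_of_le_ne_top hB (Op_le hb (kL_le (fun _ => clp_le _)) v)
  have aux : ∀ a : ℝ, 0 ≤ a ∧ a ≤ 1 → 1 - clp a = ENNReal.ofReal (1 - a) := fun a ha => by
    rw [clp_eq ha, ENNReal.ofReal_sub _ ha.1, ENNReal.ofReal_one]
  have aux4 : ∀ a c d e : ℝ, 0 ≤ a ∧ a ≤ 1 → 0 ≤ c ∧ c ≤ 1 → 0 ≤ d ∧ d ≤ 1 → 0 ≤ e ∧ e ≤ 1 →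
      0 ≤ a * c * (1 - d) * (1 - e) ∧
      clp a * clp c * (1 - clp d) * (1 - clp e) =
        ENNReal.ofReal (a * c * (1 - d) * (1 - e)) := by
    intro a c d e ha hc hd he
    have h1 : 0 ≤ 1 - d := by linarith [hd.2]
    have h2 : 0 ≤ 1 - e := by linarith [he.2]
    have h3 := ha.1
    have h4 := hc.1
    refine ⟨by positivity, ?_⟩
    rw [aux d hd, aux e he, clp_eq ha, clp_eq hc, ENNReal.ofReal_mul (by positivity),
      ENNReal.ofReal_mul (by positivity), ENNReal.ofReal_mul (by positivity)]
  obtain ⟨i1, e1⟩ := Op_toReal hb hb0 v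
    (k := kG fun w => clp (g w))
    (r := fun p => g (vPrime v p.2 p.1) * g (vsPrime v p.2 p.1) * (1 - g v) * (1 - g p.2))
    (by fun_prop) hGfin (by
      filter_upwards [hv] with p hp
      exact aux4 _ _ _ _ hp.2.2.1 hp.2.2.2 hp.1 hp.2.1)
  obtain ⟨i2, e2⟩ := Op_toReal hb hb0 v
    (k := kL fun w => clp (g w))
    (r := fun p => g v * g p.2 * (1 - g (vPrime v p.2 p.1)) * (1 - g (vsPrime v p.2 p.1)))
    (by fun_prop) hLfin (by
      filter_upwards [hv] with p hp
      exact aux4 _ _ _ _ hp.1 hp.2.1 hp.2.2.1 hp.2.2.2)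
  rw [← e1, ← e2, ← integral_sub i1 i2]
  have i3 := i1.sub i2
  unfold nu2 at i3 ⊢
  unfold Qcoll
  rw [integral_prod]
  · simp only [mul_sub]
  · exact i3

lemma measurable_Qcoll (hb : Measurable b) {f : ℝ × R3 × R3 → ℝ} (hf : Measurable f) :
    Measurable fun z : ℝ × R3 × R3 => Qcoll b (fun w => f (z.1, z.2.1, w)) z.2.2 := by
  unfold Qcoll
  have h1 : StronglyMeasurable fun x : (((ℝ × R3 × R3) × S2) × R3) =>
      b (x.1.1.2.2 - x.2, x.1.2) *
        (f (x.1.1.1, x.1.1.2.1, vPrime x.1.1.2.2 x.2 x.1.2) *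
          f (x.1.1.1, x.1.1.2.1, vsPrime x.1.1.2.2 x.2 x.1.2) *
          (1 - f (x.1.1.1, x.1.1.2.1, x.1.1.2.2)) * (1 - f (x.1.1.1, x.1.1.2.1, x.2))
          - f (x.1.1.1, x.1.1.2.1, x.1.1.2.2) * f (x.1.1.1, x.1.1.2.1, x.2)
          * (1 - f (x.1.1.1, x.1.1.2.1, vPrime x.1.1.2.2 x.2 x.1.2))
          * (1 - f (x.1.1.1, x.1.1.2.1, vsPrime x.1.1.2.2 x.2 x.1.2))) := by
    refine Measurable.stronglyMeasurable ?_
    fun_prop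
  exact (h1.integral_prod_right' (ν := (volume : Measure R3))).integral_prod_right'
    (ν := sphMeasure) |>.measurable

end

def OG (b : R3 × S2 → ℝ) (F : ℝ × R3 × R3 → ℝ≥0∞) (z : ℝ × R3 × R3) : ℝ≥0∞ :=
  Op b (kG fun w => F (z.1, z.2.1, w)) z.2.2
def OL (b : R3 × S2 → ℝ) (F : ℝ × R3 × R3 → ℝ≥0∞) (z : ℝ × R3 × R3) : ℝ≥0∞ :=
  Op b (kL fun w => F (z.1, z.2.1, w)) z.2.2
def OQ (b : R3 × S2 → ℝ) (F : ℝ × R3 × R3 → ℝ≥0∞) (z : ℝ × R3 × R3) : ℝ≥0∞ :=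
  Op b (kQ fun w => F (z.1, z.2.1, w)) z.2.2

/-- free transport -/
def tr (s : ℝ) (q : R3 × R3) : ℝ × R3 × R3 := (s, q.1 + s • q.2, q.2)

section
variable {b : R3 × S2 → ℝ} {F : ℝ × R3 × R3 → ℝ≥0∞}

lemma measurable_OG (hb : Measurable b) (hF : Measurable F) : Measurable (OG b F) := by
  have hbe := measurable_be hb
  have hK : Measurable fun x : (ℝ × R3 × R3) × (S2 × R3) => be b (x.2.1, x.1.2.2, x.2.2) *
      kG (fun w => F (x.1.1, x.1.2.1, w)) (x.2.1, x.1.2.2, x.2.2) := by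
    unfold kG Phi
    fun_prop
  exact hK.lintegral_prod_right'

lemma measurable_OL (hb : Measurable b) (hF : Measurable F) : Measurable (OL b F) := by
  have hbe := measurable_be hb
  have hK : Measurable fun x : (ℝ × R3 × R3) × (S2 × R3) => be b (x.2.1, x.1.2.2, x.2.2) *
      kL (fun w => F (x.1.1, x.1.2.1, w)) (x.2.1, x.1.2.2, x.2.2) := by
    unfold kL Phi
    fun_prop
  exact hK.lintegral_prod_right'

lemma measurable_OQ (hb : Measurable b) (hF : Measurable F) : Measurable (OQ b F) := by
  have hbe := measurable_be hb
  have hK : Measurable fun x : (ℝ × R3 × R3) × (S2 × R3) => be b (x.2.1, x.1.2.2, x.2.2) *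
      kQ (fun w => F (x.1.1, x.1.2.1, w)) (x.2.1, x.1.2.2, x.2.2) := by
    unfold kQ Phi
    fun_prop
  exact hK.lintegral_prod_right'

lemma measurable_tr : Measurable fun p : ℝ × (R3 × R3) => tr p.1 p.2 := by unfold tr; fun_prop

lemma measurable_tr1 (s : ℝ) : Measurable (tr s) := by unfold tr; fun_prop
lemma measurable_tr2 (q : R3 × R3) : Measurable fun s => tr s q := by unfold tr; fun_prop

lemma lintegral_tr (s : ℝ) {h : ℝ × R3 × R3 → ℝ≥0∞} (hh : Measurable h) :
    ∫⁻ q, h (tr s q) = ∫⁻ q, h (s, q) :=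
  (shear_mp s).lintegral_comp (f := fun q => h (s, q)) (by fun_prop)

lemma ae_tr (s : ℝ) {P : ℝ × R3 × R3 → Prop} (h : ∀ᵐ q, P (s, q)) : ∀ᵐ q, P (tr s q) :=
  (shear_mp s).quasiMeasurePreserving.ae h

lemma ae_tr_symm (s : ℝ) {P : ℝ × R3 × R3 → Prop} (h : ∀ᵐ q, P (tr s q)) : ∀ᵐ q, P (s, q) := by
  have := (shear_mp (-s)).quasiMeasurePreserving.ae h
  filter_upwards [this] with q hq
  simpa [tr] using hq

lemma energy_OQ (hb : Measurable b) (hb_sym : ∃ q : ℝ × ℝ → ℝ, Measurable q ∧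
      ∀ (w : R3) (ω : S2), b (w, ω) = q (‖w‖, |⟪w, (ω : R3)⟫|))
    (hF : Measurable F) (hF1 : ∀ z, F z ≤ 1) (s : ℝ) :
    ∫⁻ q : R3 × R3, e2 q.2 * OQ b F (s, q) ≤ 2 * bB b * ∫⁻ q : R3 × R3, e2 q.2 * F (s, q) := by
  have h1 := measurable_OQ hb hF
  rw [Measure.volume_eq_prod, lintegral_prod _ (by fun_prop), lintegral_prod _ (by fun_prop),
    ← lintegral_const_mul _ (Measurable.lintegral_prod_right' (f := fun q : R3 × R3 => e2 q.2 * F (s, q)) (by fun_prop))]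
  refine lintegral_mono fun x => ?_
  exact energy_kQ hb hb_sym (by fun_prop) (fun _ => hF1 _)

lemma energy_OGL (hb : Measurable b) (hb_sym : ∃ q : ℝ × ℝ → ℝ, Measurable q ∧
      ∀ (w : R3) (ω : S2), b (w, ω) = q (‖w‖, |⟪w, (ω : R3)⟫|))
    (hF : Measurable F) (s : ℝ) :
    ∫⁻ q : R3 × R3, e2 q.2 * OG b F (s, q) = ∫⁻ q : R3 × R3, e2 q.2 * OL b F (s, q) := by
  have h1 := measurable_OG hb hF
  have h2 := measurable_OL hb hF
  rw [Measure.volume_eq_prod, lintegral_prod _ (by fun_prop), lintegral_prod _ (by fun_prop)]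
  refine lintegral_congr fun x => ?_
  exact energy_eq hb hb_sym (G := fun v => F (s, x, v)) (by fun_prop)

lemma OG_le_OQ (z : ℝ × R3 × R3) : OG b F z ≤ OQ b F z := Op_mono (fun p => kG_le_kQ p) _

lemma OQ_le (hb : Measurable b) (hF1 : ∀ z, F z ≤ 1) (z : ℝ × R3 × R3) : OQ b F z ≤ bB b :=
  Op_le hb (kQ_le fun _ => hF1 _) _
lemma OG_le (hb : Measurable b) (hF1 : ∀ z, F z ≤ 1) (z : ℝ × R3 × R3) : OG b F z ≤ bB b :=
  (OG_le_OQ z).trans (OQ_le hb hF1 z)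
lemma OL_le (hb : Measurable b) (hF1 : ∀ z, F z ≤ 1) (z : ℝ × R3 × R3) : OL b F z ≤ bB b :=
  Op_le hb (kL_le fun _ => hF1 _) _

lemma OQ_compare (hb : Measurable b) {H : ℝ × R3 × R3 → ℝ≥0∞} (hF : Measurable F)
    (hH : Measurable H) (hF1 : ∀ z, F z ≤ 1) (hH1 : ∀ z, H z ≤ 1) (c : ℝ≥0∞) (s : ℝ)
    (h : ∀ᵐ q, F (s, q) ≤ H (s, q) + c) :
    ∀ᵐ q, OQ b F (s, q) ≤ OQ b H (s, q) + 2 * bB b * c := by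
  have h1 := measurable_OQ hb hF
  have h2 := measurable_OQ hb hH
  rw [Measure.volume_eq_prod, Measure.ae_prod_iff_ae_ae
    (measurableSet_le (by fun_prop) (by fun_prop))]
  filter_upwards [Measure.ae_ae_of_ae_prod h] with x hx
  exact kQ_compare hb (by fun_prop) (fun _ => hF1 _) (fun _ => hH1 _) c hx

/-- real collision term -/
def Qr (b : R3 × S2 → ℝ) (F : ℝ × R3 × R3 → ℝ≥0∞) (z : ℝ × R3 × R3) : ℝ :=
  (OG b F z).toReal - (OL b F z).toReal

lemma measurable_Qr (hb : Measurable b) (hF : Measurable F) : Measurable (Qr b F) :=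
  (measurable_OG hb hF).ennreal_toReal.sub (measurable_OL hb hF).ennreal_toReal

lemma Qcoll_Qr (hb : Measurable b) (hb0 : ∀ p, 0 ≤ b p) (hB : bB b ≠ ∞)
    {f : ℝ × R3 × R3 → ℝ} (hf : Measurable f) (s : ℝ)
    (h : ∀ᵐ q, 0 ≤ f (s, q) ∧ f (s, q) ≤ 1) :
    ∀ᵐ q : R3 × R3, Qcoll b (fun w => f (s, q.1, w)) q.2 = Qr b (fun z => clp (f z)) (s, q) := by
  have h1 := measurable_Qcoll hb hf
  have h2 := measurable_Qr hb (F := fun z => clp (f z)) (by fun_prop)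
  have h1s : Measurable fun q : R3 × R3 => Qcoll b (fun w => f (s, q.1, w)) q.2 :=
    h1.comp (measurable_const.prodMk measurable_id : Measurable fun q : R3 × R3 => (s, q))
  rw [Measure.volume_eq_prod, Measure.ae_prod_iff_ae_ae
    (measurableSet_eq_fun h1s (by fun_prop))]
  filter_upwards [Measure.ae_ae_of_ae_prod h] with x hx
  exact Qcoll_eq hb hb0 hB (g := fun v => f (s, x, v)) (by fun_prop) hx

/-- Everything we need along characteristics. -/
lemma mild_char (hb : Measurable b) (hb0 : ∀ p, 0 ≤ b p) (hB : bB b ≠ ∞)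
    {f₀ : R3 × R3 → ℝ} (hf₀ : ∀ᵐ q, 0 ≤ f₀ q ∧ f₀ q ≤ 1)
    {f : ℝ × R3 × R3 → ℝ} (hf : Measurable f)
    (hf_bd : ∀ᵐ p ∂(volume : Measure (ℝ × R3 × R3)).restrict
        (Set.Ici (0 : ℝ) ×ˢ (Set.univ : Set (R3 × R3))), 0 ≤ f p ∧ f p ≤ 1)
    (hf_mild : IsMildSolution b f₀ f) :
    ∀ᵐ q, ∀ t, 0 ≤ t → (0 ≤ f (tr t q) ∧ f (tr t q) ≤ 1) ∧
      (ENNReal.ofReal (f (tr t q)) + ∫⁻ s in Set.Ioc 0 t, OL b (fun z => clp (f z)) (tr s q)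
        = ENNReal.ofReal (f₀ q) + ∫⁻ s in Set.Ioc 0 t, OG b (fun z => clp (f z)) (tr s q)) ∧
      ∀ a, 0 ≤ a → a ≤ t → ENNReal.ofReal |f (tr t q) - f (tr a q)| ≤
        ∫⁻ s in Set.Ioc a t, (OG b (fun z => clp (f z)) (tr s q)
          + OL b (fun z => clp (f z)) (tr s q)) := by
  set F : ℝ × R3 × R3 → ℝ≥0∞ := fun z => clp (f z) with hFdef
  have hF : Measurable F := by fun_prop
  have hF1 : ∀ z, F z ≤ 1 := fun z => clp_le _
  have mG := measurable_OG hb hF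
  have mL := measurable_OL hb hF
  have mQ := measurable_Qr hb hF
  have mC := measurable_Qcoll hb hf
  have mt := measurable_tr
  have hbd : ∀ᵐ s ∂(volume.restrict (Set.Ici (0:ℝ))), ∀ᵐ q, 0 ≤ f (s, q) ∧ f (s, q) ≤ 1 := by
    rw [Measure.volume_eq_prod, ← Measure.prod_restrict, Measure.restrict_univ] at hf_bd
    exact Measure.ae_ae_of_ae_prod hf_bd
  have hbd' : ∀ᵐ q, ∀ᵐ s ∂(volume.restrict (Set.Ici (0:ℝ))),
      0 ≤ f (tr s q) ∧ f (tr s q) ≤ 1 := by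
    refine (Measure.ae_ae_comm ?_).1 ?_
    · exact (measurableSet_le measurable_const (hf.comp mt)).inter
        (measurableSet_le (hf.comp mt) measurable_const)
    · filter_upwards [hbd] with s hs
      exact ae_tr s (P := fun z => 0 ≤ f z ∧ f z ≤ 1) hs
  have hQ' : ∀ᵐ q : R3 × R3, ∀ᵐ s ∂(volume.restrict (Set.Ici (0:ℝ))),
      Qcoll b (fun w => f (s, q.1 + s • q.2, w)) q.2 = Qr b F (tr s q) := by
    refine (Measure.ae_ae_comm ?_).1 ?_
    · exact measurableSet_eq_fun (mC.comp mt) (mQ.comp mt)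
    · filter_upwards [hbd] with s hs
      exact ae_tr s (P := fun z => Qcoll b (fun w => f (z.1, z.2.1, w)) z.2.2 = Qr b F z)
        (Qcoll_Qr hb hb0 hB hf s hs)
  filter_upwards [hf_mild, hbd', hQ', hf₀] with q hm hbq hQq h0q
  have mt2 := measurable_tr2 q
  have iG : ∀ a c : ℝ, IntervalIntegrable (fun s => (OG b F (tr s q)).toReal) volume a c := by
    intro a c
    refine (intervalIntegrable_const (c := (bB b).toReal)).mono_fun
      (mG.comp mt2).ennreal_toReal.aestronglyMeasurable (Filter.Eventually.of_forall fun s => ?_)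
    simp only [Real.norm_eq_abs, ENNReal.abs_toReal]
    exact ENNReal.toReal_mono hB (OG_le hb hF1 _)
  have iL : ∀ a c : ℝ, IntervalIntegrable (fun s => (OL b F (tr s q)).toReal) volume a c := by
    intro a c
    refine (intervalIntegrable_const (c := (bB b).toReal)).mono_fun
      (mL.comp mt2).ennreal_toReal.aestronglyMeasurable (Filter.Eventually.of_forall fun s => ?_)
    simp only [Real.norm_eq_abs, ENNReal.abs_toReal]
    exact ENNReal.toReal_mono hB (OL_le hb hF1 _)
  have iQ : ∀ a c : ℝ, IntervalIntegrable (fun s => Qr b F (tr s q)) volume a c :=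
    fun a c => (iG a c).sub (iL a c)
  have eG : ∀ a c : ℝ, a ≤ c → ENNReal.ofReal (∫ s in a..c, (OG b F (tr s q)).toReal)
      = ∫⁻ s in Set.Ioc a c, OG b F (tr s q) := by
    intro a c hac
    rw [intervalIntegral.integral_of_le hac, ofReal_integral_eq_lintegral_ofReal
      ((intervalIntegrable_iff_integrableOn_Ioc_of_le hac).1 (iG a c))
      (Filter.Eventually.of_forall fun _ => ENNReal.toReal_nonneg)]
    exact lintegral_congr fun s => ENNReal.ofReal_toReal (ne_top_of_le_ne_top hB (OG_le hb hF1 _))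
  have eL : ∀ a c : ℝ, a ≤ c → ENNReal.ofReal (∫ s in a..c, (OL b F (tr s q)).toReal)
      = ∫⁻ s in Set.Ioc a c, OL b F (tr s q) := by
    intro a c hac
    rw [intervalIntegral.integral_of_le hac, ofReal_integral_eq_lintegral_ofReal
      ((intervalIntegrable_iff_integrableOn_Ioc_of_le hac).1 (iL a c))
      (Filter.Eventually.of_forall fun _ => ENNReal.toReal_nonneg)]
    exact lintegral_congr fun s => ENNReal.ofReal_toReal (ne_top_of_le_ne_top hB (OL_le hb hF1 _))
  have pG : ∀ a c : ℝ, a ≤ c → 0 ≤ ∫ s in a..c, (OG b F (tr s q)).toReal := fun a c hac =>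
    intervalIntegral.integral_nonneg hac fun _ _ => ENNReal.toReal_nonneg
  have pL : ∀ a c : ℝ, a ≤ c → 0 ≤ ∫ s in a..c, (OL b F (tr s q)).toReal := fun a c hac =>
    intervalIntegral.integral_nonneg hac fun _ _ => ENNReal.toReal_nonneg
  have hm2 : ∀ t, 0 ≤ t → f (tr t q) = f₀ q + ∫ s in (0:ℝ)..t, Qr b F (tr s q) := by
    intro t ht
    refine (hm t ht).trans ?_
    congr 1
    refine intervalIntegral.integral_congr_ae ?_
    rw [Set.uIoc_of_le ht]
    rw [ae_restrict_iff' measurableSet_Ici] at hQq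
    filter_upwards [hQq] with s hs hmem
    exact hs hmem.1.le
  have hcont : Continuous fun t => f₀ q + ∫ s in (0:ℝ)..t, Qr b F (tr s q) :=
    continuous_const.add (intervalIntegral.continuous_primitive iQ 0)
  have hrange : ∀ t, 0 ≤ t → 0 ≤ f (tr t q) ∧ f (tr t q) ≤ 1 := by
    have hE := Measure.eqOn_of_ae_eq (μ := (volume : Measure ℝ)) (s := Set.Ici (0:ℝ))
      (f := fun t => f₀ q + ∫ s in (0:ℝ)..t, Qr b F (tr s q))
      (g := fun t => max 0 (min 1 (f₀ q + ∫ s in (0:ℝ)..t, Qr b F (tr s q)))) (by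
        rw [Filter.EventuallyEq, ae_restrict_iff' measurableSet_Ici]
        rw [ae_restrict_iff' measurableSet_Ici] at hbq
        filter_upwards [hbq] with t ht hmem
        obtain ⟨x1, x2⟩ := ht hmem
        rw [hm2 t hmem] at x1 x2
        rw [min_eq_right x2, max_eq_right x1]) hcont.continuousOn
      (by exact (continuous_const.max (continuous_const.min hcont)).continuousOn) (by simp)
    intro t ht
    have h := hE (Set.mem_Ici.2 ht)
    simp only at h
    rw [hm2 t ht, h]
    exact ⟨le_max_left _ _, max_le zero_le_one (min_le_left _ _)⟩
  have hsplit : ∀ a c : ℝ, ∫ s in a..c, Qr b F (tr s q) = (∫ s in a..c, (OG b F (tr s q)).toReal)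
      - ∫ s in a..c, (OL b F (tr s q)).toReal := fun a c =>
    intervalIntegral.integral_sub (iG a c) (iL a c)
  intro t ht
  refine ⟨hrange t ht, ?_, ?_⟩
  · rw [← eG 0 t ht, ← eL 0 t ht, ← ENNReal.ofReal_add (hrange t ht).1 (pL 0 t ht),
      ← ENNReal.ofReal_add h0q.1 (pG 0 t ht), hm2 t ht, hsplit]
    congr 1
    ring
  · intro a ha hat
    have hdiff : f (tr t q) - f (tr a q) = (∫ s in a..t, (OG b F (tr s q)).toReal)
        - ∫ s in a..t, (OL b F (tr s q)).toReal := by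
      rw [hm2 t ht, hm2 a ha, ← hsplit, ← intervalIntegral.integral_add_adjacent_intervals
        (iQ 0 a) (iQ a t)]
      ring
    rw [lintegral_add_left (f := fun s => OG b F (tr s q)) (mG.comp mt2), ← eG a t hat, ← eL a t hat,
      ← ENNReal.ofReal_add (pG a t hat) (pL a t hat), hdiff]
    refine ENNReal.ofReal_le_ofReal ?_
    rw [abs_le]
    constructor <;> linarith [pG a t hat, pL a t hat]

end

section

def cN (κ : ℝ) (n : ℕ) (t : ℝ) : ℝ≥0∞ := ENNReal.ofReal ((κ * t) ^ n / n.factorial)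

lemma cN_int {κ : ℝ} (hκ : 0 ≤ κ) (n : ℕ) {t : ℝ} (ht : 0 ≤ t) :
    ∫⁻ s in Set.Ioc 0 t, ENNReal.ofReal κ * cN κ n s = cN κ (n + 1) t := by
  have hc : Continuous fun s : ℝ => κ * ((κ * s) ^ n / n.factorial) := by fun_prop
  have hi := hc.intervalIntegrable (μ := volume) 0 t
  have h1 : ∫⁻ s in Set.Ioc 0 t, ENNReal.ofReal κ * cN κ n s
      = ∫⁻ s in Set.Ioc 0 t, ENNReal.ofReal (κ * ((κ * s) ^ n / n.factorial)) := by
    refine lintegral_congr fun s => ?_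
    unfold cN
    rw [ENNReal.ofReal_mul hκ]
  rw [h1, ← ofReal_integral_eq_lintegral_ofReal
    ((intervalIntegrable_iff_integrableOn_Ioc_of_le ht).1 hi)
    ((ae_restrict_iff' measurableSet_Ioc).2 (Filter.Eventually.of_forall fun s hs => by
      have := hs.1.le
      simp only [Pi.zero_apply]
      positivity)), ← intervalIntegral.integral_of_le ht]
  unfold cN
  congr 1
  have h2 : ∀ s : ℝ, κ * ((κ * s) ^ n / n.factorial) = κ ^ (n + 1) / n.factorial * s ^ n := by
    intro s; ring
  simp_rw [h2]
  rw [intervalIntegral.integral_const_mul, integral_pow, Nat.factorial_succ]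
  push_cast
  have : (n.factorial : ℝ) ≠ 0 := by positivity
  have : (n : ℝ) + 1 ≠ 0 := by positivity
  field_simp
  ring

lemma exp_int {κ : ℝ} (hκ : 0 ≤ κ) {t : ℝ} (ht : 0 ≤ t) :
    1 + ∫⁻ s in Set.Ioc 0 t, ENNReal.ofReal κ * ENNReal.ofReal (Real.exp (κ * s))
      = ENNReal.ofReal (Real.exp (κ * t)) := by
  have hc : Continuous fun s : ℝ => κ * Real.exp (κ * s) := by fun_prop
  have hi := hc.intervalIntegrable (μ := volume) 0 t
  have hI : ∫ s in (0:ℝ)..t, κ * Real.exp (κ * s) = Real.exp (κ * t) - Real.exp (κ * 0) := by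
    refine intervalIntegral.integral_eq_sub_of_hasDerivAt (f := fun s => Real.exp (κ * s))
      (fun s _ => ?_) hi
    have := ((hasDerivAt_id s).const_mul κ).exp
    simpa [mul_comm] using this
  simp_rw [← ENNReal.ofReal_mul hκ]
  rw [← ofReal_integral_eq_lintegral_ofReal
    ((intervalIntegrable_iff_integrableOn_Ioc_of_le ht).1 hi)
    (Filter.Eventually.of_forall fun s => by simp only [Pi.zero_apply]; positivity),
    ← intervalIntegral.integral_of_le ht, hI, ← ENNReal.ofReal_one, ← ENNReal.ofReal_add]
  · congr 1; simp
  · norm_num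
  · simp only [mul_zero, Real.exp_zero, sub_nonneg, Real.one_le_exp_iff]; positivity

variable {b : R3 × S2 → ℝ} {F : ℝ × R3 × R3 → ℝ≥0∞} {F₀ : R3 × R3 → ℝ≥0∞}

/-- one Picard step -/
def pic (b : R3 × S2 → ℝ) (F₀ : R3 × R3 → ℝ≥0∞) (g : ℝ × R3 × R3 → ℝ≥0∞) (z : ℝ × R3 × R3) :
    ℝ≥0∞ :=
  min 1 (F₀ (z.2.1 - z.1 • z.2.2, z.2.2) +
    ∫⁻ s, if 0 < s ∧ s ≤ z.1 then OQ b g (tr s (z.2.1 - z.1 • z.2.2, z.2.2)) else 0)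

lemma pic_tr (g : ℝ × R3 × R3 → ℝ≥0∞) (t : ℝ) (q : R3 × R3) :
    pic b F₀ g (tr t q) = min 1 (F₀ q + ∫⁻ s in Set.Ioc 0 t, OQ b g (tr s q)) := by
  have hq : (((tr t q).2.1 - (tr t q).1 • (tr t q).2.2, (tr t q).2.2) : R3 × R3) = q := by
    simp [tr]
  unfold pic
  rw [hq, ← lintegral_indicator measurableSet_Ioc]
  congr 2
  refine lintegral_congr fun s => ?_
  by_cases h : 0 < s ∧ s ≤ t
  · rw [Set.indicator_of_mem (show s ∈ Set.Ioc 0 t from h)]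
    exact if_pos h
  · rw [Set.indicator_of_notMem (show s ∉ Set.Ioc 0 t from h)]
    exact if_neg h

lemma measurable_pic (hb : Measurable b) (hF₀ : Measurable F₀) {g : ℝ × R3 × R3 → ℝ≥0∞}
    (hg : Measurable g) : Measurable (pic b F₀ g) := by
  have hO := measurable_OQ hb hg
  have h1 : Measurable fun x : (ℝ × R3 × R3) × ℝ => if 0 < x.2 ∧ x.2 ≤ x.1.1 then
      OQ b g (tr x.2 (x.1.2.1 - x.1.1 • x.1.2.2, x.1.2.2)) else 0 := by
    refine Measurable.ite ?_ ?_ measurable_const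
    · exact (measurableSet_lt measurable_const measurable_snd).inter
        (measurableSet_le measurable_snd measurable_fst.fst)
    · unfold tr; fun_prop
  have h2 : Measurable fun z : ℝ × R3 × R3 => ∫⁻ s, if 0 < s ∧ s ≤ z.1 then
      OQ b g (tr s (z.2.1 - z.1 • z.2.2, z.2.2)) else 0 := h1.lintegral_prod_right'
  unfold pic
  refine measurable_const.min (Measurable.add ?_ h2)
  fun_prop

lemma iter_exists (hb : Measurable b) (hB : bB b ≠ ∞) (hb_sym : ∃ q : ℝ × ℝ → ℝ, Measurable q ∧
      ∀ (w : R3) (ω : S2), b (w, ω) = q (‖w‖, |⟪w, (ω : R3)⟫|))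
    (hF : Measurable F) (hF1 : ∀ z, F z ≤ 1) (hF₀ : Measurable F₀)
    (hineq : ∀ᵐ q, ∀ t, 0 ≤ t →
      F (tr t q) ≤ F₀ q + ∫⁻ s in Set.Ioc 0 t, OQ b F (tr s q)) (n : ℕ) :
    ∃ g : ℝ × R3 × R3 → ℝ≥0∞, Measurable g ∧ (∀ z, g z ≤ 1) ∧
      (∀ t, 0 ≤ t → ∀ᵐ q, F (t, q) ≤ g (t, q) + cN (2 * (bB b).toReal) n t) ∧
      (∀ t, 0 ≤ t → ∫⁻ q : R3 × R3, e2 q.2 * g (t, q) ≤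
        (∫⁻ q : R3 × R3, e2 q.2 * F₀ q) * ENNReal.ofReal (Real.exp (2 * (bB b).toReal * t))) := by
  set κ := 2 * (bB b).toReal with hκdef
  have hκ : 0 ≤ κ := by positivity
  have hκB : ENNReal.ofReal κ = 2 * bB b := by
    rw [hκdef, ENNReal.ofReal_mul (by norm_num), ENNReal.ofReal_toReal hB]; simp
  have mt := measurable_tr
  induction n with
  | zero =>
    refine ⟨fun _ => 0, measurable_const, by simp, fun t _ => ?_, by simp⟩
    refine Filter.Eventually.of_forall fun q => ?_
    simpa [cN] using hF1 _
  | succ n ih =>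
    obtain ⟨g, hg, hg1, hcmp, hen⟩ := ih
    have mO := measurable_OQ hb hg
    have mOF := measurable_OQ hb hF
    have mp := measurable_pic hb hF₀ hg
    refine ⟨pic b F₀ g, mp, fun z => min_le_left _ _, fun t ht => ?_, fun t ht => ?_⟩
    · refine ae_tr_symm t (P := fun z => F z ≤ pic b F₀ g z + cN κ (n + 1) t) ?_
      have hswap : ∀ᵐ q, ∀ᵐ s ∂(volume.restrict (Set.Ioc 0 t)),
          OQ b F (tr s q) ≤ OQ b g (tr s q) + ENNReal.ofReal κ * cN κ n s := by
        refine (Measure.ae_ae_comm ?_).1 ?_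
        · refine measurableSet_le (mOF.comp mt) ((mO.comp mt).add ?_)
          unfold cN
          fun_prop
        · rw [ae_restrict_iff' measurableSet_Ioc]
          refine Filter.Eventually.of_forall fun s hs => ?_
          refine ae_tr s (P := fun z => OQ b F z ≤ OQ b g z + ENNReal.ofReal κ * cN κ n s) ?_
          rw [hκB]
          exact OQ_compare hb hF hg hF1 hg1 _ s (hcmp s hs.1.le)
      filter_upwards [hineq, hswap] with q h1 h2
      rw [pic_tr, min_add]
      refine le_min ((hF1 _).trans le_self_add) ((h1 t ht).trans ?_)
      rw [add_assoc, ← cN_int hκ n ht, ← lintegral_add_left (f := fun s => OQ b g (tr s q))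
        (mO.comp (measurable_tr2 q))]
      exact add_le_add le_rfl (lintegral_mono_ae h2)
    · have e1 : ∫⁻ q : R3 × R3, e2 q.2 * pic b F₀ g (t, q)
          = ∫⁻ q : R3 × R3, e2 q.2 * pic b F₀ g (tr t q) :=
        (lintegral_tr t (h := fun z => e2 z.2.2 * pic b F₀ g z) (by fun_prop)).symm
      rw [e1]
      set E0 := ∫⁻ q : R3 × R3, e2 q.2 * F₀ q with hE0
      have mI : Measurable fun x : (R3 × R3) × ℝ => e2 x.1.2 * OQ b g (tr x.2 x.1) := by
        unfold tr; fun_prop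
      calc ∫⁻ q : R3 × R3, e2 q.2 * pic b F₀ g (tr t q)
          ≤ ∫⁻ q : R3 × R3, (e2 q.2 * F₀ q
              + ∫⁻ s in Set.Ioc 0 t, e2 q.2 * OQ b g (tr s q)) := by
            refine lintegral_mono fun q => ?_
            simp only
            rw [lintegral_const_mul (f := fun s => OQ b g (tr s q)) _ (mO.comp (measurable_tr2 q)),
              ← mul_add, pic_tr]
            gcongr
            exact min_le_right _ _
        _ = E0 + ∫⁻ q : R3 × R3, ∫⁻ s in Set.Ioc 0 t, e2 q.2 * OQ b g (tr s q) :=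
            lintegral_add_left (by fun_prop) _
        _ = E0 + ∫⁻ s in Set.Ioc 0 t, ∫⁻ q : R3 × R3, e2 q.2 * OQ b g (tr s q) := by
            rw [lintegral_lintegral_swap]
            exact mI.aemeasurable
        _ ≤ E0 + ∫⁻ s in Set.Ioc 0 t, E0 *
              (ENNReal.ofReal κ * ENNReal.ofReal (Real.exp (κ * s))) := by
            refine add_le_add le_rfl (setLIntegral_mono (by fun_prop) fun s hs => ?_)
            rw [show ∫⁻ q : R3 × R3, e2 q.2 * OQ b g (tr s q)
                = ∫⁻ q : R3 × R3, e2 q.2 * OQ b g (s, q) from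
              lintegral_tr s (h := fun z => e2 z.2.2 * OQ b g z) (by fun_prop)]
            refine (energy_OQ hb hb_sym hg hg1 s).trans ?_
            rw [← hκB]
            calc _ ≤ ENNReal.ofReal κ * (E0 * ENNReal.ofReal (Real.exp (κ * s))) := by
                  gcongr
                  exact hen s hs.1.le
              _ = _ := by ring
        _ = E0 * (1 + ∫⁻ s in Set.Ioc 0 t,
              (ENNReal.ofReal κ * ENNReal.ofReal (Real.exp (κ * s)))) := by
            rw [lintegral_const_mul _ (by fun_prop), mul_add, mul_one]
        _ = _ := by rw [exp_int hκ ht]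

lemma apriori (hb : Measurable b) (hB : bB b ≠ ∞) (hb_sym : ∃ q : ℝ × ℝ → ℝ, Measurable q ∧
      ∀ (w : R3) (ω : S2), b (w, ω) = q (‖w‖, |⟪w, (ω : R3)⟫|))
    (hF : Measurable F) (hF1 : ∀ z, F z ≤ 1) (hF₀ : Measurable F₀)
    (hineq : ∀ᵐ q, ∀ t, 0 ≤ t →
      F (tr t q) ≤ F₀ q + ∫⁻ s in Set.Ioc 0 t, OQ b F (tr s q)) {t : ℝ} (ht : 0 ≤ t) :
    ∫⁻ q : R3 × R3, e2 q.2 * F (t, q) ≤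
        (∫⁻ q : R3 × R3, e2 q.2 * F₀ q) * ENNReal.ofReal (Real.exp (2 * (bB b).toReal * t)) := by
  choose g hg hg1 hcmp hen using iter_exists hb hB hb_sym hF hF1 hF₀ hineq
  have hall : ∀ᵐ q, ∀ n, F (t, q) ≤ g n (t, q) + cN (2 * (bB b).toReal) n t :=
    ae_all_iff.2 fun n => hcmp n t ht
  have hc : Filter.Tendsto (fun n => cN (2 * (bB b).toReal) n t) Filter.atTop (nhds 0) := by
    unfold cN
    rw [← ENNReal.ofReal_zero]
    exact ENNReal.tendsto_ofReal (FloorSemiring.tendsto_pow_div_factorial_atTop _)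
  calc ∫⁻ q : R3 × R3, e2 q.2 * F (t, q)
      ≤ ∫⁻ q : R3 × R3, Filter.liminf (fun n => e2 q.2 * g n (t, q)) Filter.atTop := by
        refine lintegral_mono_ae ?_
        filter_upwards [hall] with q hq
        have h1 : Filter.Tendsto (fun n => e2 q.2 * (F (t, q) - cN (2 * (bB b).toReal) n t))
            Filter.atTop (nhds (e2 q.2 * (F (t, q) - 0))) := by
          refine ENNReal.Tendsto.const_mul ?_ (Or.inr ?_)
          · exact ENNReal.Tendsto.sub tendsto_const_nhds hc (Or.inr (by simp))
          · exact ENNReal.ofReal_ne_top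
        rw [tsub_zero] at h1
        rw [← h1.liminf_eq]
        refine Filter.liminf_le_liminf (Filter.Eventually.of_forall fun n => ?_)
        gcongr
        exact tsub_le_iff_right.2 (hq n)
    _ ≤ Filter.liminf (fun n => ∫⁻ q : R3 × R3, e2 q.2 * g n (t, q)) Filter.atTop :=
        lintegral_liminf_le fun n => by
          have := hg n
          fun_prop
    _ ≤ Filter.liminf (fun _ : ℕ => (∫⁻ q : R3 × R3, e2 q.2 * F₀ q) *
          ENNReal.ofReal (Real.exp (2 * (bB b).toReal * t))) Filter.atTop :=
        Filter.liminf_le_liminf (Filter.Eventually.of_forall fun n => hen n t ht)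
    _ = _ := Filter.liminf_const _

end

section

variable {b : R3 × S2 → ℝ} {F : ℝ × R3 × R3 → ℝ≥0∞} {F₀ : R3 × R3 → ℝ≥0∞}

lemma lintegral_tr_e2 (s : ℝ) {h : ℝ × R3 × R3 → ℝ≥0∞} (hh : Measurable h) :
    ∫⁻ q : R3 × R3, e2 q.2 * h (tr s q) = ∫⁻ q : R3 × R3, e2 q.2 * h (s, q) :=
  lintegral_tr s (h := fun z => e2 z.2.2 * h z) (by fun_prop)

lemma lintegral_time_swap (a t : ℝ) {h : ℝ × R3 × R3 → ℝ≥0∞} (hh : Measurable h) :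
    ∫⁻ q : R3 × R3, e2 q.2 * ∫⁻ s in Set.Ioc a t, h (tr s q)
      = ∫⁻ s in Set.Ioc a t, ∫⁻ q : R3 × R3, e2 q.2 * h (s, q) := by
  have mI : Measurable fun x : (R3 × R3) × ℝ => e2 x.1.2 * h (tr x.2 x.1) := by
    unfold tr; fun_prop
  calc ∫⁻ q : R3 × R3, e2 q.2 * ∫⁻ s in Set.Ioc a t, h (tr s q)
      = ∫⁻ q : R3 × R3, ∫⁻ s in Set.Ioc a t, e2 q.2 * h (tr s q) := by
        refine lintegral_congr fun q => ?_
        rw [lintegral_const_mul (f := fun s => h (tr s q)) _ (hh.comp (measurable_tr2 q))]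
    _ = ∫⁻ s in Set.Ioc a t, ∫⁻ q : R3 × R3, e2 q.2 * h (tr s q) := by
        rw [lintegral_lintegral_swap]
        exact mI.aemeasurable
    _ = _ := lintegral_congr fun s => lintegral_tr_e2 s hh

lemma shear_cont {h : R3 × R3 → ℝ} (hi : Integrable h) (t : ℝ) :
    Filter.Tendsto (fun s : ℝ => ∫⁻ q : R3 × R3,
      ‖h (q.1 + s • q.2, q.2) - h (q.1 + t • q.2, q.2)‖ₑ) (nhds t) (nhds 0) := by
  let g : ℝ → C(R3 × R3, R3 × R3) := fun s => ⟨fun q => (q.1 + s • q.2, q.2), by fun_prop⟩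
  have hg : Continuous g := by
    refine ContinuousMap.continuous_of_continuous_uncurry _ ?_
    change Continuous fun x : ℝ × (R3 × R3) => (x.2.1 + x.1 • x.2.2, x.2.2)
    fun_prop
  have hm : MemLp h 1 (volume : Measure (R3 × R3)) := memLp_one_iff_integrable.2 hi
  have hgm : ∀ s, MeasurePreserving (g s) (volume : Measure (R3 × R3)) volume := shear_mp
  have hc : Filter.Tendsto (fun s => Lp.compMeasurePreserving (g s) (hgm s) (hm.toLp h)) (nhds t)
      (nhds (Lp.compMeasurePreserving (g t) (hgm t) (hm.toLp h))) :=
    Filter.Tendsto.compMeasurePreservingLp tendsto_const_nhds (hg.tendsto t) hgm (hgm t) (by simp)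
  rw [tendsto_iff_edist_tendsto_0] at hc
  refine hc.congr fun s => ?_
  rw [Lp.toLp_compMeasurePreserving hm, Lp.toLp_compMeasurePreserving hm, Lp.edist_toLp_toLp,
    eLpNorm_one_eq_lintegral_enorm]
  rfl

lemma energy_bound_OGL (hb : Measurable b) (hb_sym : ∃ q : ℝ × ℝ → ℝ, Measurable q ∧
      ∀ (w : R3) (ω : S2), b (w, ω) = q (‖w‖, |⟪w, (ω : R3)⟫|))
    (hF : Measurable F) (hF1 : ∀ z, F z ≤ 1) (s : ℝ) :
    ∫⁻ q : R3 × R3, e2 q.2 * (OG b F (s, q) + OL b F (s, q)) ≤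
      4 * bB b * ∫⁻ q : R3 × R3, e2 q.2 * F (s, q) := by
  have mG := measurable_OG hb hF
  have mL := measurable_OL hb hF
  simp_rw [mul_add]
  rw [lintegral_add_left (by fun_prop), ← energy_OGL hb hb_sym hF s]
  have h1 : ∫⁻ q : R3 × R3, e2 q.2 * OG b F (s, q) ≤
      2 * bB b * ∫⁻ q : R3 × R3, e2 q.2 * F (s, q) :=
    (lintegral_mono fun q => by gcongr; exact OG_le_OQ _).trans (energy_OQ hb hb_sym hF hF1 s)
  refine (add_le_add h1 h1).trans_eq ?_
  ring

lemma energy_main (hb : Measurable b) (hb0 : ∀ p, 0 ≤ b p) (hB : bB b ≠ ∞)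
    (hb_sym : ∃ q : ℝ × ℝ → ℝ, Measurable q ∧
      ∀ (w : R3) (ω : S2), b (w, ω) = q (‖w‖, |⟪w, (ω : R3)⟫|))
    {f₀ : R3 × R3 → ℝ} (hf₀m : Measurable f₀) (hf₀ : ∀ᵐ q, 0 ≤ f₀ q ∧ f₀ q ≤ 1)
    {f : ℝ × R3 × R3 → ℝ} (hf : Measurable f)
    (hf_bd : ∀ᵐ p ∂(volume : Measure (ℝ × R3 × R3)).restrict
        (Set.Ici (0 : ℝ) ×ˢ (Set.univ : Set (R3 × R3))), 0 ≤ f p ∧ f p ≤ 1)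
    (hf_mild : IsMildSolution b f₀ f)
    (hE : ∫⁻ q : R3 × R3, e2 q.2 * ENNReal.ofReal (f₀ q) ≠ ∞) {t : ℝ} (ht : 0 ≤ t) :
    ∫⁻ q : R3 × R3, e2 q.2 * clp (f (t, q))
      = ∫⁻ q : R3 × R3, e2 q.2 * ENNReal.ofReal (f₀ q) := by
  have hch := mild_char hb hb0 hB hf₀ hf hf_bd hf_mild
  set F : ℝ × R3 × R3 → ℝ≥0∞ := fun z => clp (f z) with hFdef
  have hF : Measurable F := by fun_prop
  have hF1 : ∀ z, F z ≤ 1 := fun z => clp_le _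
  have mG := measurable_OG hb hF
  have mL := measurable_OL hb hF
  set E0 := ∫⁻ q : R3 × R3, e2 q.2 * ENNReal.ofReal (f₀ q) with hE0
  have hap : ∀ s, 0 ≤ s → ∫⁻ q : R3 × R3, e2 q.2 * F (s, q) ≤
      E0 * ENNReal.ofReal (Real.exp (2 * (bB b).toReal * s)) := fun s hs => by
    refine apriori hb hB hb_sym hF hF1 (F₀ := fun q => ENNReal.ofReal (f₀ q)) (by fun_prop) ?_ hs
    filter_upwards [hch] with q hq r hr
    obtain ⟨h1, h2, -⟩ := hq r hr
    calc F (tr r q) = ENNReal.ofReal (f (tr r q)) := clp_eq h1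
      _ ≤ _ := le_self_add
      _ = _ := h2
      _ ≤ _ := add_le_add le_rfl (lintegral_mono fun s => OG_le_OQ _)
  have hI : ∫⁻ q : R3 × R3, (e2 q.2 * ENNReal.ofReal (f (tr t q))
        + e2 q.2 * ∫⁻ s in Set.Ioc 0 t, OL b F (tr s q))
      = ∫⁻ q : R3 × R3, (e2 q.2 * ENNReal.ofReal (f₀ q)
        + e2 q.2 * ∫⁻ s in Set.Ioc 0 t, OG b F (tr s q)) := by
    refine lintegral_congr_ae ?_
    filter_upwards [hch] with q hq
    rw [← mul_add, ← mul_add, (hq t ht).2.1]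
  have mt1 := measurable_tr1 t
  rw [lintegral_add_left (by fun_prop), lintegral_add_left (by fun_prop),
    lintegral_time_swap _ _ mL, lintegral_time_swap _ _ mG] at hI
  simp_rw [energy_OGL hb hb_sym hF] at hI
  have hfin : ∫⁻ s in Set.Ioc 0 t, ∫⁻ q : R3 × R3, e2 q.2 * OL b F (s, q) ≠ ∞ := by
    set K := 2 * bB b * (E0 * ENNReal.ofReal (Real.exp (2 * (bB b).toReal * t))) with hK
    have hKt : K ≠ ∞ := by
      rw [hK]
      exact ENNReal.mul_ne_top (ENNReal.mul_ne_top (by simp) hB)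
        (ENNReal.mul_ne_top hE ENNReal.ofReal_ne_top)
    have : ∫⁻ s in Set.Ioc 0 t, ∫⁻ q : R3 × R3, e2 q.2 * OL b F (s, q)
        ≤ ∫⁻ s in Set.Ioc 0 t, K := by
      refine setLIntegral_mono measurable_const fun s hs => ?_
      rw [← energy_OGL hb hb_sym hF]
      refine (lintegral_mono fun q => mul_le_mul' le_rfl (OG_le_OQ _)).trans ?_
      refine (energy_OQ hb hb_sym hF hF1 s).trans ?_
      rw [hK]
      gcongr
      refine (hap s hs.1.le).trans ?_
      gcongr
      exact hs.2
    refine ne_top_of_le_ne_top ?_ this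
    rw [setLIntegral_const, Real.volume_Ioc]
    exact ENNReal.mul_ne_top hKt ENNReal.ofReal_ne_top
  have hI' := (ENNReal.add_left_inj hfin).1 hI
  rw [hE0, ← hI']
  refine Eq.trans (lintegral_tr_e2 t hF).symm ?_
  refine lintegral_congr_ae ?_
  filter_upwards [hch] with q hq
  rw [hFdef]
  simp only
  rw [clp_eq (hq t ht).1]

end

section

variable {b : R3 × S2 → ℝ}

lemma time_cont (hb : Measurable b) (hb0 : ∀ p, 0 ≤ b p) (hB : bB b ≠ ∞)
    (hb_sym : ∃ q : ℝ × ℝ → ℝ, Measurable q ∧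
      ∀ (w : R3) (ω : S2), b (w, ω) = q (‖w‖, |⟪w, (ω : R3)⟫|))
    {f₀ : R3 × R3 → ℝ} (hf₀m : Measurable f₀) (hf₀ : ∀ᵐ q, 0 ≤ f₀ q ∧ f₀ q ≤ 1)
    {f : ℝ × R3 × R3 → ℝ} (hf : Measurable f)
    (hf_bd : ∀ᵐ p ∂(volume : Measure (ℝ × R3 × R3)).restrict
        (Set.Ici (0 : ℝ) ×ˢ (Set.univ : Set (R3 × R3))), 0 ≤ f p ∧ f p ≤ 1)
    (hf_mild : IsMildSolution b f₀ f)
    (hE : ∫⁻ q : R3 × R3, e2 q.2 * ENNReal.ofReal (f₀ q) ≠ ∞) {s t : ℝ} (hs : 0 ≤ s)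
    (ht : 0 ≤ t) :
    ∫⁻ q : R3 × R3, e2 q.2 * ENNReal.ofReal |f (tr s q) - f (tr t q)|
      ≤ 4 * bB b * (∫⁻ q : R3 × R3, e2 q.2 * ENNReal.ofReal (f₀ q)) * ENNReal.ofReal |s - t| := by
  wlog hst : s ≤ t generalizing s t
  · have := this ht hs (not_le.1 hst).le
    rw [abs_sub_comm s t]
    simpa only [abs_sub_comm] using this
  have hch := mild_char hb hb0 hB hf₀ hf hf_bd hf_mild
  have hem := fun r (hr : 0 ≤ r) =>
    energy_main hb hb0 hB hb_sym hf₀m hf₀ hf hf_bd hf_mild hE (t := r) hr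
  set F : ℝ × R3 × R3 → ℝ≥0∞ := fun z => clp (f z) with hFdef
  have hF : Measurable F := by fun_prop
  have hF1 : ∀ z, F z ≤ 1 := fun z => clp_le _
  have mG := measurable_OG hb hF
  have mL := measurable_OL hb hF
  calc _ ≤ ∫⁻ q : R3 × R3, e2 q.2 * ∫⁻ r in Set.Ioc s t, (OG b F (tr r q) + OL b F (tr r q)) := by
        refine lintegral_mono_ae ?_
        filter_upwards [hch] with q hq
        rw [abs_sub_comm]
        exact mul_le_mul' le_rfl ((hq t ht).2.2 s hs hst)
    _ = ∫⁻ r in Set.Ioc s t, ∫⁻ q : R3 × R3, e2 q.2 * (OG b F (r, q) + OL b F (r, q)) :=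
        lintegral_time_swap s t (h := fun z => OG b F z + OL b F z) (by fun_prop)
    _ ≤ ∫⁻ r in Set.Ioc s t, 4 * bB b * ∫⁻ q : R3 × R3, e2 q.2 * ENNReal.ofReal (f₀ q) := by
        refine setLIntegral_mono measurable_const fun r hr => ?_
        refine (energy_bound_OGL hb hb_sym hF hF1 r).trans_eq ?_
        congr 1
        exact hem r (hs.trans hr.1.le)
    _ = _ := by
        rw [setLIntegral_const, Real.volume_Ioc, abs_sub_comm, abs_of_nonneg (sub_nonneg.2 hst)]

end

/-- Conservation of the total kinetic energy: under the symmetry assumption on the kernel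
and finiteness of `∫∫ (1+|v|²) f₀`, the function `|v|² f` belongs to
`C⁰([0,∞); L¹(ℝ³×ℝ³))`, the total kinetic energy is conserved, and `|v|² Q(f)` belongs
to `L^∞([0,∞); L¹(ℝ³×ℝ³))`. -/
theorem mild_solution_energy_conservation
    (b : R3 × S2 → ℝ) (hb_meas : Measurable b) (hb_nonneg : ∀ p, 0 ≤ b p)
    (hb_int : Integrable b ((volume : Measure R3).prod sphMeasure))
    (hb_sym : ∃ q : ℝ × ℝ → ℝ, Measurable q ∧
      ∀ (w : R3) (ω : S2), b (w, ω) = q (‖w‖, |⟪w, (ω : R3)⟫|))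
    (f₀ : R3 × R3 → ℝ) (hf₀_meas : Measurable f₀)
    (hf₀_bd : ∀ᵐ q : R3 × R3 ∂(volume : Measure (R3 × R3)), 0 ≤ f₀ q ∧ f₀ q ≤ 1)
    (hf₀_mom : Integrable (fun q : R3 × R3 => (1 + ‖q.2‖ ^ 2) * f₀ q)
      (volume : Measure (R3 × R3)))
    (f : ℝ × R3 × R3 → ℝ) (hf_meas : Measurable f)
    (hf_bd : ∀ᵐ p ∂(volume : Measure (ℝ × R3 × R3)).restrict
        (Set.Ici (0 : ℝ) ×ˢ (Set.univ : Set (R3 × R3))), 0 ≤ f p ∧ f p ≤ 1)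
    (hf_mild : IsMildSolution b f₀ f) :
    (∀ t : ℝ, 0 ≤ t → Integrable (fun q : R3 × R3 => ‖q.2‖ ^ 2 * f (t, q.1, q.2))
        (volume : Measure (R3 × R3))) ∧
    (∀ t : ℝ, 0 ≤ t →
      Filter.Tendsto
        (fun s => ∫ q : R3 × R3, ‖q.2‖ ^ 2 * |f (s, q.1, q.2) - f (t, q.1, q.2)|
          ∂(volume : Measure (R3 × R3)))
        (nhdsWithin t (Set.Ici (0 : ℝ))) (nhds 0)) ∧
    (∀ t : ℝ, 0 ≤ t →
      ∫ q : R3 × R3, ‖q.2‖ ^ 2 * f (t, q.1, q.2) ∂(volume : Measure (R3 × R3)) =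
        ∫ q : R3 × R3, ‖q.2‖ ^ 2 * f₀ q ∂(volume : Measure (R3 × R3))) ∧
    (∃ C : ℝ, ∀ t : ℝ, 0 ≤ t →
      Integrable (fun q : R3 × R3 => ‖q.2‖ ^ 2 * |Qcoll b (fun w => f (t, q.1, w)) q.2|)
        (volume : Measure (R3 × R3)) ∧
      ∫ q : R3 × R3, ‖q.2‖ ^ 2 * |Qcoll b (fun w => f (t, q.1, w)) q.2|
          ∂(volume : Measure (R3 × R3)) ≤ C) := by
  have hB : bB b ≠ ∞ :=
    ((hasFiniteIntegral_iff_ofReal (Filter.Eventually.of_forall hb_nonneg)).1 hb_int.2).ne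
  have hE : ∫⁻ q : R3 × R3, e2 q.2 * ENNReal.ofReal (f₀ q) ≠ ∞ := by
    have h1 := (hasFiniteIntegral_iff_ofReal (by
      filter_upwards [hf₀_bd] with q hq
      have := hq.1
      simp only [Pi.zero_apply]
      positivity)).1 hf₀_mom.2
    refine ne_top_of_le_ne_top h1.ne (lintegral_mono_ae ?_)
    filter_upwards [hf₀_bd] with q hq
    unfold e2
    rw [← ENNReal.ofReal_mul (by positivity)]
    refine ENNReal.ofReal_le_ofReal ?_
    nlinarith [hq.1]
  have hch := mild_char hb_meas hb_nonneg hB hf₀_bd hf_meas hf_bd hf_mild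
  have hbd : ∀ t, 0 ≤ t → ∀ᵐ q, 0 ≤ f (t, q) ∧ f (t, q) ≤ 1 := fun t ht =>
    ae_tr_symm t (P := fun z => 0 ≤ f z ∧ f z ≤ 1) (by
      filter_upwards [hch] with q hq using (hq t ht).1)
  have hem := fun r (hr : 0 ≤ r) =>
    energy_main hb_meas hb_nonneg hB hb_sym hf₀_meas hf₀_bd hf_meas hf_bd hf_mild hE (t := r) hr
  have htc := fun s t (hs : 0 ≤ s) (ht : 0 ≤ t) =>
    time_cont hb_meas hb_nonneg hB hb_sym hf₀_meas hf₀_bd hf_meas hf_bd hf_mild hE hs ht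
  set E0 := ∫⁻ q : R3 × R3, e2 q.2 * ENNReal.ofReal (f₀ q) with hE0
  have hof : ∀ (v : R3) (y : ℝ), ENNReal.ofReal (‖v‖ ^ 2 * y) = e2 v * ENNReal.ofReal y :=
    fun v y => ENNReal.ofReal_mul (by positivity)
  have hlin : ∀ t, 0 ≤ t → ∫⁻ q : R3 × R3, ENNReal.ofReal (‖q.2‖ ^ 2 * f (t, q.1, q.2)) = E0 := by
    intro t ht
    rw [← hem t ht]
    refine lintegral_congr_ae ?_
    filter_upwards [hbd t ht] with q hq
    rw [hof, clp_eq hq]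
  have hIntg : ∀ t : ℝ, 0 ≤ t → Integrable (fun q : R3 × R3 => ‖q.2‖ ^ 2 * f (t, q.1, q.2))
      (volume : Measure (R3 × R3)) := by
    intro t ht
    refine ⟨(by fun_prop : Measurable _).aestronglyMeasurable, ?_⟩
    rw [hasFiniteIntegral_iff_ofReal, hlin t ht]
    · exact hE.lt_top
    · filter_upwards [hbd t ht] with q hq
      exact mul_nonneg (by positivity) hq.1
  refine ⟨hIntg, ?_, ?_, ?_⟩
  · intro t ht
    have hS := shear_cont (hIntg t ht) t
    have hlt : Filter.Tendsto (fun s => 4 * bB b * E0 * ENNReal.ofReal |s - t|) (nhds t)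
        (nhds 0) := by
      have h1 : Filter.Tendsto (fun s : ℝ => ENNReal.ofReal |s - t|) (nhds t) (nhds 0) := by
        have : Continuous fun s : ℝ => ENNReal.ofReal |s - t| :=
          ENNReal.continuous_ofReal.comp (by fun_prop)
        simpa using this.tendsto t
      have := ENNReal.Tendsto.const_mul (a := 4 * bB b * E0) h1 (Or.inr
        (ENNReal.mul_ne_top (ENNReal.mul_ne_top (by simp) hB) hE))
      simpa using this
    have hsum := (hlt.add hS).mono_left (nhdsWithin_le_nhds (s := Set.Ici (0:ℝ)))
    rw [add_zero] at hsum
    have hD : Filter.Tendsto (fun s => ∫⁻ q : R3 × R3, ENNReal.ofReal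
        (‖q.2‖ ^ 2 * |f (s, q.1, q.2) - f (t, q.1, q.2)|)) (nhdsWithin t (Set.Ici (0 : ℝ)))
        (nhds 0) := by
      refine tendsto_of_tendsto_of_tendsto_of_le_of_le' tendsto_const_nhds hsum
        (Filter.Eventually.of_forall fun _ => zero_le) ?_
      filter_upwards [self_mem_nhdsWithin] with s hs
      have ms := measurable_tr1 s
      have mt := measurable_tr1 t
      calc ∫⁻ q : R3 × R3, ENNReal.ofReal (‖q.2‖ ^ 2 * |f (s, q.1, q.2) - f (t, q.1, q.2)|)
          = ∫⁻ q : R3 × R3, e2 q.2 * ENNReal.ofReal |f (s, q) - f (t, q)| :=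
            lintegral_congr fun q => hof _ _
        _ = ∫⁻ q : R3 × R3, e2 q.2 * ENNReal.ofReal |f (tr s q) - f (t, (tr s q).2)| :=
            (lintegral_tr_e2 s (h := fun z => ENNReal.ofReal |f z - f (t, z.2)|)
              (Measurable.ennreal_ofReal (by fun_prop))).symm
        _ ≤ ∫⁻ q : R3 × R3, (e2 q.2 * ENNReal.ofReal |f (tr s q) - f (tr t q)|
            + ‖‖q.2‖ ^ 2 * f (t, q.1 + s • q.2, q.2) - ‖q.2‖ ^ 2 * f (t, q.1 + t • q.2, q.2)‖ₑ) := by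
            refine lintegral_mono fun q => ?_
            simp only
            rw [← mul_sub, ← ofReal_norm, norm_mul, Real.norm_eq_abs, Real.norm_eq_abs,
              abs_of_nonneg (by positivity : 0 ≤ ‖q.2‖ ^ 2), hof, ← mul_add,
              ← ENNReal.ofReal_add (abs_nonneg _) (abs_nonneg _)]
            refine mul_le_mul' le_rfl (ENNReal.ofReal_le_ofReal ?_)
            rw [abs_sub_comm (f (t, q.1 + s • q.2, q.2))]
            exact abs_sub_le _ _ _
        _ = (∫⁻ q : R3 × R3, e2 q.2 * ENNReal.ofReal |f (tr s q) - f (tr t q)|)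
            + ∫⁻ q : R3 × R3, ‖‖q.2‖ ^ 2 * f (t, q.1 + s • q.2, q.2)
              - ‖q.2‖ ^ 2 * f (t, q.1 + t • q.2, q.2)‖ₑ := by
            refine lintegral_add_left (Measurable.mul (by fun_prop)
              (Measurable.ennreal_ofReal ?_)) _
            exact (continuous_abs.measurable.comp ((hf_meas.comp ms).sub (hf_meas.comp mt)))
        _ ≤ _ := add_le_add (htc s t hs ht) le_rfl
    have h0 := (ENNReal.tendsto_toReal ENNReal.zero_ne_top).comp hD
    refine h0.congr fun s => ?_
    rw [integral_eq_lintegral_of_nonneg_ae]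
    · rfl
    · exact Filter.Eventually.of_forall fun q => by simp only [Pi.zero_apply]; positivity
    · refine Measurable.aestronglyMeasurable (Measurable.mul (by fun_prop) ?_)
      exact continuous_abs.measurable.comp (by fun_prop)
  · intro t ht
    rw [integral_eq_lintegral_of_nonneg_ae, integral_eq_lintegral_of_nonneg_ae, hlin t ht]
    · simp_rw [hof]
      rfl
    · filter_upwards [hf₀_bd] with q hq
      exact mul_nonneg (by positivity) hq.1
    · exact (by fun_prop : Measurable _).aestronglyMeasurable
    · filter_upwards [hbd t ht] with q hq
      exact mul_nonneg (by positivity) hq.1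
    · exact (hIntg t ht).1
  · refine ⟨(4 * bB b * E0).toReal, fun t ht => ?_⟩
    have hfinC : 4 * bB b * E0 ≠ ∞ := ENNReal.mul_ne_top (ENNReal.mul_ne_top (by simp) hB) hE
    have hF : Measurable fun z => clp (f z) := by fun_prop
    have hF1 : ∀ z, clp (f z) ≤ 1 := fun z => clp_le _
    have hle : ∫⁻ q : R3 × R3, ENNReal.ofReal
        (‖q.2‖ ^ 2 * |Qcoll b (fun w => f (t, q.1, w)) q.2|) ≤ 4 * bB b * E0 := by
      rw [← hem t ht]
      refine le_trans (lintegral_mono_ae ?_) (energy_bound_OGL hb_meas hb_sym hF hF1 t)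
      filter_upwards [Qcoll_Qr hb_meas hb_nonneg hB hf_meas t (hbd t ht)] with q hq
      rw [hq, hof]
      refine mul_le_mul' le_rfl ?_
      unfold Qr
      have g1 := ne_top_of_le_ne_top hB (OG_le hb_meas hF1 (t, q))
      have g2 := ne_top_of_le_ne_top hB (OL_le hb_meas hF1 (t, q))
      rw [← ENNReal.ofReal_toReal g1, ← ENNReal.ofReal_toReal g2, ← ENNReal.ofReal_add
        ENNReal.toReal_nonneg ENNReal.toReal_nonneg, ENNReal.toReal_ofReal ENNReal.toReal_nonneg,
        ENNReal.toReal_ofReal ENNReal.toReal_nonneg]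
      refine ENNReal.ofReal_le_ofReal ?_
      have p1 : 0 ≤ (OG b (fun z => clp (f z)) (t, q)).toReal := ENNReal.toReal_nonneg
      have p2 : 0 ≤ (OL b (fun z => clp (f z)) (t, q)).toReal := ENNReal.toReal_nonneg
      rw [abs_le]
      constructor <;> linarith
    have mQ : Measurable fun q : R3 × R3 => Qcoll b (fun w => f (t, q.1, w)) q.2 :=
      (measurable_Qcoll hb_meas hf_meas).comp
        (measurable_const.prodMk measurable_id : Measurable fun q : R3 × R3 => (t, q))
    have mm : AEStronglyMeasurable (fun q : R3 × R3 =>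
        ‖q.2‖ ^ 2 * |Qcoll b (fun w => f (t, q.1, w)) q.2|) volume :=
      (Measurable.mul (by fun_prop) (continuous_abs.measurable.comp mQ)).aestronglyMeasurable
    have hnn : 0 ≤ᵐ[volume] (fun q : R3 × R3 =>
        ‖q.2‖ ^ 2 * |Qcoll b (fun w => f (t, q.1, w)) q.2|) :=
      Filter.Eventually.of_forall fun q => by simp only [Pi.zero_apply]; positivity
    refine ⟨⟨mm, ?_⟩, ?_⟩
    · rw [hasFiniteIntegral_iff_ofReal hnn]
      exact hle.trans_lt hfinC.lt_top
    · rw [integral_eq_lintegral_of_nonneg_ae hnn mm]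
      exact ENNReal.toReal_mono hfinC hle
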